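/- arXiv:2111.03198 — 13 statements merged into one kernel-verified Lean document; each statement's English description precedes it below -/
import Mathlib

section
/- For every positive integer w and every ε > 0, set γ = w^{-1}·exp(−4w⁶/ε). Then there exists a function f̂ : [0,1]^w → [0,1] that is monotone and DR-submodular on [0,1]^w and satisfies: (1) f̂(x) = g(x) for every x ∈ [0,1]^w with max_{i,j∈[w]} |x_i − x_j| ≤ γ; and (2) f(x) − ε ≤ f̂(x) ≤ f(x) for every x ∈ [0,1]^w. -/
open Finset Function

/-- Projection of the real line onto the unit interval. -/
noncomputable def unitClamp (t : ℝ) : ℝ := max 0 (min 1 t)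

lemma unitClamp_nonneg (t : ℝ) : 0 ≤ unitClamp t := le_max_left _ _

lemma unitClamp_le_one (t : ℝ) : unitClamp t ≤ 1 :=
  max_le zero_le_one (min_le_left _ _)

lemma unitClamp_of_nonpos {t : ℝ} (h : t ≤ 0) : unitClamp t = 0 :=
  max_eq_left ((min_le_right _ _).trans h)

lemma unitClamp_of_one_le {t : ℝ} (h : 1 ≤ t) : unitClamp t = 1 := by
  rw [unitClamp, min_eq_left h]; exact max_eq_right zero_le_one

lemma unitClamp_of_mem {t : ℝ} (h0 : 0 ≤ t) (h1 : t ≤ 1) : unitClamp t = t := by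
  rw [unitClamp, min_eq_right h1, max_eq_right h0]

lemma abs_unitClamp_sub_le (s t : ℝ) : |unitClamp s - unitClamp t| ≤ |s - t| := by
  unfold unitClamp
  refine (abs_max_sub_max_le_max 0 (min 1 s) 0 (min 1 t)).trans ?_
  refine max_le (by simp) ?_
  refine (abs_min_sub_min_le_max 1 s 1 t).trans ?_
  exact max_le (by simp) le_rfl

lemma continuous_unitClamp : Continuous unitClamp :=
  continuous_const.max (continuous_const.min continuous_id)

lemma hasDerivAt_comp_unitClamp {p p' : ℝ → ℝ} (hp : ∀ t, HasDerivAt p (p' t) t)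
    (h0 : p' 0 = 0) (h1 : p' 1 = 0) (t : ℝ) :
    HasDerivAt (fun s => p (unitClamp s)) (p' (unitClamp t)) t := by
  by_cases ht : 0 < t ∧ t < 1
  · rw [unitClamp_of_mem ht.1.le ht.2.le]
    refine (hp t).congr_of_eventuallyEq ?_
    filter_upwards [Ioo_mem_nhds ht.1 ht.2] with s hs
    rw [unitClamp_of_mem hs.1.le hs.2.le]
  · have hz : p' (unitClamp t) = 0 := by
      rcases le_or_gt t 0 with h | h
      · rw [unitClamp_of_nonpos h, h0]
      · rw [unitClamp_of_one_le (not_lt.1 fun h' => ht ⟨h, h'⟩), h1]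
    have h := hp (unitClamp t)
    rw [hz] at h ⊢
    rw [hasDerivAt_iff_isLittleO] at h ⊢
    simp only [smul_zero, sub_zero] at h ⊢
    have hc := h.comp_tendsto (continuous_unitClamp.tendsto t)
    refine hc.trans_isBigO (Asymptotics.IsBigO.of_bound 1 (Filter.Eventually.of_forall fun s => ?_))
    simpa using abs_unitClamp_sub_le s t

/-- A twice differentiable transition function on a logarithmic scale: it vanishes on `[0, a]`,
equals `1` on `[a * exp L, ∞)`, and its derivatives are of order `1 / L` relative to the scale. -/
lemma exists_log_cutoff {a L : ℝ} (ha : 0 < a) (hL : 0 < L) :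
    ∃ θ θ₁ θ₂ : ℝ → ℝ, (∀ x, HasDerivAt θ (θ₁ x) x) ∧ (∀ x, HasDerivAt θ₁ (θ₂ x) x) ∧
      (∀ x, 0 ≤ θ x) ∧ (∀ x, θ x ≤ 1) ∧ (∀ x, 0 ≤ x → x ≤ a → θ x = 0) ∧
      (∀ x, a * Real.exp L ≤ x → θ x = 1) ∧ (∀ x, |θ₁ x * x| ≤ 2 / L) ∧
      (∀ x, |θ₂ x * x ^ 2| ≤ 15 / L ^ 2 + 2 / L) := by
  set S : ℝ → ℝ := fun t => 6 * t ^ 5 - 15 * t ^ 4 + 10 * t ^ 3 with hS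
  set S₁ : ℝ → ℝ := fun t => 30 * t ^ 2 * (1 - t) ^ 2 with hS₁
  set S₂ : ℝ → ℝ := fun t => 60 * t * (1 - t) * (1 - 2 * t) with hS₂
  have dS : ∀ t, HasDerivAt S (S₁ t) t := fun t => by
    have := (((hasDerivAt_id t).pow 5).const_mul 6).sub (((hasDerivAt_id t).pow 4).const_mul 15)
      |>.add (((hasDerivAt_id t).pow 3).const_mul 10)
    refine this.congr_deriv ?_
    simp [hS₁]; ring
  have dS₁ : ∀ t, HasDerivAt S₁ (S₂ t) t := fun t => by
    have := (((hasDerivAt_id t).pow 2).const_mul 30).mul (((hasDerivAt_id t).const_sub 1).pow 2)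
    refine this.congr_deriv ?_
    simp [hS₂]; ring
  have dT := hasDerivAt_comp_unitClamp dS (by simp [hS₁]) (by simp [hS₁])
  have dT₁ := hasDerivAt_comp_unitClamp dS₁ (by simp [hS₂]) (by simp [hS₂])
  set ℓ : ℝ → ℝ := fun x => Real.log (x / a) / L with hℓ
  have dℓ : ∀ x, x ≠ 0 → HasDerivAt ℓ (1 / (L * x)) x := fun x hx => by
    have := (((hasDerivAt_id x).div_const a).log (by simp [hx, ha.ne'])).div_const L
    refine this.congr_deriv ?_
    simp only [id]; field_simp
  have near : ∀ x, |x| ≤ a → unitClamp (ℓ x) = 0 := fun x hx => by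
    refine unitClamp_of_nonpos (div_nonpos_of_nonpos_of_nonneg ?_ hL.le)
    rw [← Real.log_abs]
    refine Real.log_nonpos (abs_nonneg _) ?_
    rw [abs_div, abs_of_pos ha]
    exact (div_le_one ha).2 hx
  have near' : ∀ᶠ x in nhds (0 : ℝ), unitClamp (ℓ x) = 0 := by
    filter_upwards [Metric.closedBall_mem_nhds (0 : ℝ) ha] with x hx
    exact near x (by simpa using hx)
  have b₁ : ∀ t, 0 ≤ S₁ (unitClamp t) ∧ S₁ (unitClamp t) ≤ 2 := fun t => by
    have h0 := unitClamp_nonneg t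
    have h1 := unitClamp_le_one t
    generalize unitClamp t = c at *
    have e : S₁ c = 30 * (c * (1 - c)) ^ 2 := by simp only [hS₁]; ring
    have : c * (1 - c) ≤ 1 / 4 := by nlinarith [sq_nonneg (c - 1 / 2)]
    have : 0 ≤ c * (1 - c) := mul_nonneg h0 (by linarith)
    rw [e]
    constructor
    · positivity
    · nlinarith
  have b₂ : ∀ t, |S₂ (unitClamp t)| ≤ 15 := fun t => by
    have h0 := unitClamp_nonneg t
    have h1 := unitClamp_le_one t
    generalize unitClamp t = c at *
    have h4 : c * (1 - c) ≤ 1 / 4 := by nlinarith [sq_nonneg (c - 1 / 2)]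
    have h5 : 0 ≤ c * (1 - c) := mul_nonneg h0 (by linarith)
    have e : S₂ c = 60 * ((c * (1 - c)) * (1 - 2 * c)) := by simp only [hS₂]; ring
    have h6 : |1 - 2 * c| ≤ 1 := abs_le.2 ⟨by linarith, by linarith⟩
    rw [e, abs_mul, abs_mul, abs_of_nonneg h5, abs_of_pos (by norm_num : (0 : ℝ) < 60)]
    nlinarith [abs_nonneg (1 - 2 * c)]
  refine ⟨fun x => S (unitClamp (ℓ x)), fun x => S₁ (unitClamp (ℓ x)) * (1 / (L * x)),
    fun x => S₂ (unitClamp (ℓ x)) * (1 / (L * x)) ^ 2 - S₁ (unitClamp (ℓ x)) * (1 / (L * x ^ 2)),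
    fun x => ?_, fun x => ?_, fun x => ?_, fun x => ?_, fun x hx hxa => ?_, fun x hx => ?_,
    fun x => ?_, fun x => ?_⟩
  · by_cases hx : x = 0
    · subst hx
      refine (hasDerivAt_const (0 : ℝ) (S 0)).congr_of_eventuallyEq ?_ |>.congr_deriv (by simp)
      filter_upwards [near'] with x hx
      rw [hx]
    · exact (dT (ℓ x)).comp x (dℓ x hx)
  · by_cases hx : x = 0
    · subst hx
      refine (hasDerivAt_const (0 : ℝ) (0 : ℝ)).congr_of_eventuallyEq ?_ |>.congr_deriv (by simp)
      filter_upwards [near'] with x hx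
      simp [hx, hS₁]
    · have h1 := (dT₁ (ℓ x)).comp x (dℓ x hx)
      have h2 : HasDerivAt (fun x : ℝ => 1 / (L * x)) (-(1 / (L * x ^ 2))) x := by
        have := ((hasDerivAt_id x).const_mul L).inv (by simp [hx, hL.ne'])
        simp only [id, mul_one] at this
        simp only [one_div]
        refine this.congr_deriv ?_
        field_simp
      refine (h1.mul h2).congr_deriv ?_
      simp only [comp]; ring
  · change 0 ≤ S (unitClamp (ℓ x))
    have h0 := unitClamp_nonneg (ℓ x)
    generalize unitClamp (ℓ x) = c at *
    have e : S c = c ^ 3 * (6 * (c - 5 / 4) ^ 2 + 5 / 8) := by simp only [hS]; ring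
    rw [e]; positivity
  · change S (unitClamp (ℓ x)) ≤ 1
    have h0 := unitClamp_le_one (ℓ x)
    have h0' := unitClamp_nonneg (ℓ x)
    generalize unitClamp (ℓ x) = c at *
    have e : S c = 1 - (1 - c) ^ 3 * (6 * (c + 1 / 4) ^ 2 + 5 / 8) := by simp only [hS]; ring
    have : 0 ≤ (1 - c) ^ 3 := pow_nonneg (by linarith) 3
    rw [e, sub_le_self_iff]; positivity
  · simp [near x (by rwa [abs_of_nonneg hx]), hS]
  · have : 1 ≤ ℓ x := by
      rw [hℓ, one_le_div hL, Real.le_log_iff_exp_le, le_div_iff₀ ha]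
      · linarith
      · exact div_pos (lt_of_lt_of_le (by positivity) hx) ha
    simp only [unitClamp_of_one_le this, hS]; norm_num
  · by_cases hx : x = 0
    · simp only [hx, mul_zero, abs_zero]; positivity
    · have e : S₁ (unitClamp (ℓ x)) * (1 / (L * x)) * x = S₁ (unitClamp (ℓ x)) / L := by
        field_simp
      rw [e, abs_of_nonneg (div_nonneg (b₁ _).1 hL.le)]
      exact div_le_div_of_nonneg_right (b₁ _).2 hL.le
  · by_cases hx : x = 0
    · subst hx; simp; positivity
    · have e : (S₂ (unitClamp (ℓ x)) * (1 / (L * x)) ^ 2 -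
          S₁ (unitClamp (ℓ x)) * (1 / (L * x ^ 2))) * x ^ 2 =
          S₂ (unitClamp (ℓ x)) / L ^ 2 - S₁ (unitClamp (ℓ x)) / L := by
        field_simp
      rw [e]
      refine (abs_sub _ _).trans (add_le_add ?_ ?_)
      · rw [abs_div, abs_of_pos (by positivity : 0 < L ^ 2)]
        exact div_le_div_of_nonneg_right (b₂ _) (by positivity)
      · rw [abs_of_nonneg (div_nonneg (b₁ _).1 hL.le)]
        exact div_le_div_of_nonneg_right (b₁ _).2 hL.le
lemma one_sub_sum_le_prod_of_one_sub_le {ι : Type*} (s : Finset ι) {a b : ι → ℝ}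
    (ha : ∀ i ∈ s, 0 ≤ a i) (hb : ∀ i ∈ s, 0 ≤ b i) (h : ∀ i ∈ s, 1 - b i ≤ a i) :
    1 - ∑ i ∈ s, b i ≤ ∏ i ∈ s, a i := by
  classical
  induction s using Finset.induction_on with
  | empty => simp
  | insert i s hi ih =>
    rw [sum_insert hi, prod_insert hi]
    have h1 := ih (fun j hj => ha j (mem_insert_of_mem hj)) (fun j hj => hb j (mem_insert_of_mem hj))
      (fun j hj => h j (mem_insert_of_mem hj))
    have h2 := h i (mem_insert_self i s)
    have h3 := hb i (mem_insert_self i s)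
    have h4 := ha i (mem_insert_self i s)
    have h5 : 0 ≤ ∑ j ∈ s, b j := sum_nonneg fun j hj => hb j (mem_insert_of_mem hj)
    have h6 : 0 ≤ ∏ j ∈ s, a j := prod_nonneg fun j hj => ha j (mem_insert_of_mem hj)
    by_cases h7 : 1 - (b i + ∑ j ∈ s, b j) ≤ 0
    · exact h7.trans (mul_nonneg h4 h6)
    · calc 1 - (b i + ∑ j ∈ s, b j) ≤ (1 - b i) * (1 - ∑ j ∈ s, b j) := by
            nlinarith [mul_nonneg h3 h5]
        _ ≤ a i * ∏ j ∈ s, a j := mul_le_mul h2 h1 (by linarith) h4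

/-- The average of a vector of reals. -/
noncomputable def mean {w : ℕ} (z : Fin w → ℝ) : ℝ := (∑ k, z k) / w

/-- The sum of squared deviations from the average. -/
noncomputable def spread {w : ℕ} (z : Fin w → ℝ) : ℝ := ∑ k, (z k - mean z) ^ 2

lemma spread_nonneg {w : ℕ} (z : Fin w → ℝ) : 0 ≤ spread z := sum_nonneg fun _ _ => sq_nonneg _

lemma abs_sub_mean_le {w : ℕ} (z : Fin w → ℝ) (i : Fin w) : |z i - mean z| ≤ √(spread z) :=
  Real.abs_le_sqrt (single_le_sum (f := fun k => (z k - mean z) ^ 2)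
    (fun _ _ => sq_nonneg _) (mem_univ i))

section

variable {n : ℕ} {z : Fin (n + 2) → ℝ}

lemma mean_nonneg (hz : ∀ k, 0 ≤ z k) : 0 ≤ mean z :=
  div_nonneg (sum_nonneg fun k _ => hz k) (Nat.cast_nonneg _)

lemma sum_eq_mean : ∑ k, z k = (n + 2) * mean z := by
  unfold mean; push_cast; field_simp

lemma eq_zero_of_mean_eq_zero (hz : ∀ k, 0 ≤ z k) (h : mean z = 0) : z = 0 := by
  have : ∑ k, z k = 0 := by rw [sum_eq_mean, h, mul_zero]
  funext k
  exact (sum_eq_zero_iff_of_nonneg fun k _ => hz k).1 this k (mem_univ k)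

/-- Relative deviations from a nonzero average. -/
lemma exists_relative_deviation (hz : ∀ k, 0 ≤ z k) (h : 0 < mean z) :
    ∃ u : Fin (n + 2) → ℝ, (∀ k, z k = mean z * (1 + u k)) ∧ (∀ k, 0 ≤ 1 + u k) ∧
      ∑ k, u k = 0 := by
  have e : ∀ k, z k = mean z * (1 + (z k / mean z - 1)) := fun k => by field_simp; ring
  refine ⟨fun k => z k / mean z - 1, e, fun k => ?_, ?_⟩
  · have := div_nonneg (hz k) h.le
    linarith
  · rw [sum_sub_distrib, ← sum_div, sum_eq_mean]
    simp only [sum_const, card_univ, Fintype.card_fin, nsmul_eq_mul]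
    push_cast; field_simp; ring

lemma prod_le_mean_pow (hz : ∀ k, 0 ≤ z k) : ∏ k, z k ≤ mean z ^ (n + 2) := by
  rcases (mean_nonneg hz).eq_or_lt with h | h
  · rw [← h, eq_zero_of_mean_eq_zero hz h.symm]; simp
  obtain ⟨u, hu, hu0, hus⟩ := exists_relative_deviation hz h
  have : ∏ k, (1 + u k) ≤ 1 := by
    calc ∏ k, (1 + u k) ≤ ∏ k, Real.exp (u k) :=
          prod_le_prod (fun k _ => hu0 k) fun k _ => by linarith [Real.add_one_le_exp (u k)]
      _ = 1 := by rw [← Real.exp_sum, hus, Real.exp_zero]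
  rw [prod_congr rfl fun k _ => hu k, prod_mul_distrib, prod_const, card_univ, Fintype.card_fin]
  exact mul_le_of_le_one_right (by positivity) this

lemma mean_pow_sub_prod_le (hz : ∀ k, 0 ≤ z k) :
    mean z ^ (n + 2) - ∏ k, z k ≤ spread z * mean z ^ n := by
  rcases (mean_nonneg hz).eq_or_lt with h | h
  · rw [← h, eq_zero_of_mean_eq_zero hz h.symm]
    have := mul_nonneg (spread_nonneg (0 : Fin (n + 2) → ℝ)) (pow_nonneg (le_refl (0 : ℝ)) n)
    simpa using this
  obtain ⟨u, hu, hu0, hus⟩ := exists_relative_deviation hz h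
  have h1 : 1 - ∑ k, u k ^ 2 ≤ ∏ k, (1 + u k) := by
    calc 1 - ∑ k, u k ^ 2 ≤ ∏ k, ((1 + u k) * Real.exp (-u k)) := by
          refine one_sub_sum_le_prod_of_one_sub_le _ (fun k _ => ?_) (fun k _ => sq_nonneg _)
            fun k _ => ?_
          · exact mul_nonneg (hu0 k) (Real.exp_pos _).le
          · nlinarith [Real.add_one_le_exp (-u k), hu0 k]
      _ = ∏ k, (1 + u k) := by
          rw [prod_mul_distrib, ← Real.exp_sum, sum_neg_distrib, hus]; simp
  have h2 : spread z = mean z ^ 2 * ∑ k, u k ^ 2 := by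
    rw [spread, mul_sum]
    refine sum_congr rfl fun k _ => ?_
    rw [show z k - mean z = mean z * u k by rw [hu k]; ring, mul_pow]
  have h3 : ∏ k, z k = mean z ^ (n + 2) * ∏ k, (1 + u k) := by
    rw [prod_congr rfl fun k _ => hu k, prod_mul_distrib, prod_const, card_univ, Fintype.card_fin]
  rw [h2, h3]
  have := mul_le_mul_of_nonneg_left h1 (pow_nonneg h.le (n + 2))
  linear_combination this

lemma abs_mean_pow_sub_prod_erase_le (hz : ∀ k, 0 ≤ z k) (i : Fin (n + 2)) :
    |mean z ^ (n + 1) - ∏ k ∈ univ.erase i, z k| ≤ (n + 2) * √(spread z) * mean z ^ n := by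
  have hd := Real.sqrt_nonneg (spread z)
  have hcard : (univ.erase i).card = n + 1 := by simp
  rcases (mean_nonneg hz).eq_or_lt with h | h
  · have : mean z ^ (n + 1) - ∏ k ∈ univ.erase i, z k = 0 := by
      rw [← h, eq_zero_of_mean_eq_zero hz h.symm]; simp [hcard]
    rw [this, abs_zero]
    have := mean_nonneg hz
    positivity
  obtain ⟨u, hu, hu0, hus⟩ := exists_relative_deviation hz h
  have hud : ∀ k, mean z * |u k| ≤ √(spread z) := fun k => by
    have := abs_sub_mean_le z k
    rwa [show z k - mean z = mean z * u k by rw [hu k]; ring, abs_mul, abs_of_pos h] at this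
  have hprod : ∏ k ∈ univ.erase i, z k = mean z ^ (n + 1) * ∏ k ∈ univ.erase i, (1 + u k) := by
    rw [prod_congr rfl fun k _ => hu k, prod_mul_distrib, prod_const, hcard]
  have low : 1 - ∑ k ∈ univ.erase i, |u k| ≤ ∏ k ∈ univ.erase i, (1 + u k) :=
    one_sub_sum_le_prod_of_one_sub_le _ (fun k _ => hu0 k) (fun k _ => abs_nonneg _)
      fun k _ => by linarith [neg_abs_le (u k)]
  have up : ∏ k ∈ univ.erase i, (1 + u k) ≤ 1 + 2 * |u i| := by
    calc ∏ k ∈ univ.erase i, (1 + u k) ≤ ∏ k ∈ univ.erase i, Real.exp (u k) :=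
          prod_le_prod (fun k _ => hu0 k) fun k _ => by linarith [Real.add_one_le_exp (u k)]
      _ = Real.exp (-u i) := by
          rw [← Real.exp_sum]
          congr 1
          have := add_sum_erase univ u (mem_univ i)
          linarith
      _ ≤ 1 + 2 * |u i| := by
          rcases le_or_gt 0 (u i) with h0 | h0
          · have : Real.exp (-u i) ≤ 1 := Real.exp_le_one_iff.2 (by linarith)
            linarith [abs_nonneg (u i)]
          · have h1 : |-u i| ≤ 1 := by
              rw [abs_neg, abs_of_neg h0]; linarith [hu0 i]
            have h2 := (abs_le.1 (Real.abs_exp_sub_one_sub_id_le h1)).2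
            rw [abs_of_neg h0]
            rw [abs_neg, abs_of_neg h0] at h1
            nlinarith
  have hsum : mean z * ∑ k ∈ univ.erase i, |u k| ≤ (n + 1) * √(spread z) := by
    rw [mul_sum]
    refine (sum_le_card_nsmul _ _ _ fun k _ => hud k).trans ?_
    rw [hcard, nsmul_eq_mul]; push_cast; rfl
  have hm : 0 ≤ mean z ^ n := by positivity
  rw [hprod, abs_le]
  constructor
  · have h1 := mul_le_mul_of_nonneg_left up (pow_nonneg h.le (n + 1))
    have h2 := mul_le_mul_of_nonneg_left (hud i) hm
    have h3 : 0 ≤ (n : ℝ) * √(spread z) * mean z ^ n := by positivity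
    rw [pow_succ] at *
    nlinarith
  · have h1 := mul_le_mul_of_nonneg_left low (pow_nonneg h.le (n + 1))
    have h2 := mul_le_mul_of_nonneg_left hsum hm
    have h3 : 0 ≤ √(spread z) * mean z ^ n := by positivity
    rw [pow_succ] at *
    nlinarith
lemma le_of_forall_update_monotone {w : ℕ} {F : (Fin w → ℝ) → ℝ}
    (hF : ∀ z : Fin w → ℝ, (∀ k, z k ∈ Set.Icc (0 : ℝ) 1) → ∀ i,
      MonotoneOn (fun t => F (update z i t)) (Set.Icc 0 1))
    {x y : Fin w → ℝ} (hx : ∀ k, x k ∈ Set.Icc (0 : ℝ) 1) (hy : ∀ k, y k ∈ Set.Icc (0 : ℝ) 1)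
    (hxy : ∀ k, x k ≤ y k) : F x ≤ F y := by
  have key : ∀ s : Finset (Fin w), F x ≤ F (s.piecewise y x) := fun s => by
    induction s using Finset.induction_on with
    | empty => simp
    | insert i s hi ih =>
      refine ih.trans ?_
      have hb : ∀ k, s.piecewise y x k ∈ Set.Icc (0 : ℝ) 1 := fun k => by
        by_cases hk : k ∈ s
        · simpa [hk] using hy k
        · simpa [hk] using hx k
      have := hF _ hb i (hx i) (hy i) (hxy i)
      simp only at this
      rw [piecewise_insert]
      convert this using 2
      rw [show x i = s.piecewise y x i by simp [hi], update_eq_self]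
  simpa using key univ

/-- Nonnegative second partial derivatives give increasing differences. -/
lemma sub_le_sub_of_second_partials_nonneg {w : ℕ} {F : (Fin w → ℝ) → ℝ}
    {F₁ : Fin w → (Fin w → ℝ) → ℝ} {F₂ : Fin w → Fin w → (Fin w → ℝ) → ℝ}
    (h₁ : ∀ z j, HasDerivAt (fun t => F (update z j t)) (F₁ j z) (z j))
    (h₂ : ∀ z j i, HasDerivAt (fun t => F₁ j (update z i t)) (F₂ j i z) (z i))
    (hpos : ∀ z : Fin w → ℝ, (∀ k, z k ∈ Set.Icc (0 : ℝ) 1) → ∀ j i, 0 ≤ F₂ j i z)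
    {x y : Fin w → ℝ} (hx : ∀ k, x k ∈ Set.Icc (0 : ℝ) 1) (hy : ∀ k, y k ∈ Set.Icc (0 : ℝ) 1)
    (hxy : ∀ k, x k ≤ y k) (j : Fin w) {s : ℝ} (hs : 0 ≤ s) (hys : y j + s ≤ 1) :
    F (update x j (x j + s)) - F x ≤ F (update y j (y j + s)) - F y := by
  have h₁' : ∀ z j t, HasDerivAt (fun t => F (update z j t)) (F₁ j (update z j t)) t :=
    fun z j t => by simpa using h₁ (update z j t) j
  have h₂' : ∀ z j i t, HasDerivAt (fun t => F₁ j (update z i t)) (F₂ j i (update z i t)) t :=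
    fun z j i t => by simpa using h₂ (update z i t) j i
  have upd : ∀ z : Fin w → ℝ, (∀ k, z k ∈ Set.Icc (0 : ℝ) 1) → ∀ i, ∀ t ∈ Set.Icc (0 : ℝ) 1,
      ∀ k, update z i t k ∈ Set.Icc (0 : ℝ) 1 := fun z hz i t ht k => by
    by_cases hk : k = i
    · subst hk; simpa using ht
    · simpa [hk] using hz k
  have mono : ∀ j, ∀ x y : Fin w → ℝ, (∀ k, x k ∈ Set.Icc (0 : ℝ) 1) →
      (∀ k, y k ∈ Set.Icc (0 : ℝ) 1) → (∀ k, x k ≤ y k) → F₁ j x ≤ F₁ j y :=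
    fun j x y hx hy hxy => by
      refine le_of_forall_update_monotone (fun z hz i => ?_) hx hy hxy
      refine monotoneOn_of_hasDerivWithinAt_nonneg (convex_Icc _ _)
        (fun t _ => (h₂' z j i t).continuousAt.continuousWithinAt)
        (fun t _ => (h₂' z j i t).hasDerivWithinAt) fun t ht => ?_
      exact hpos _ (upd z hz i t (interior_subset ht)) j i
  have line : ∀ (z : Fin w → ℝ) (t : ℝ), HasDerivAt (fun t => F (update z j (z j + t)))
      (F₁ j (update z j (z j + t))) t := fun z t => (h₁' z j (z j + t)).comp_const_add (z j) t
  have main : MonotoneOn (fun t => F (update y j (y j + t)) - F (update x j (x j + t)))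
      (Set.Icc 0 s) := by
    refine monotoneOn_of_hasDerivWithinAt_nonneg (convex_Icc _ _)
      (fun t _ => ((line y t).sub (line x t)).continuousAt.continuousWithinAt)
      (fun t _ => ((line y t).sub (line x t)).hasDerivWithinAt) fun t ht => ?_
    have ht' : t ∈ Set.Icc 0 s := interior_subset ht
    have hxj := hx j
    have hyj := hy j
    have hj := hxy j
    refine sub_nonneg.2 (mono j _ _ (upd x hx j _ ⟨?_, ?_⟩) (upd y hy j _ ⟨?_, ?_⟩) fun k => ?_)
    · linarith [ht'.1, hxj.1]
    · linarith [ht'.2]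
    · linarith [ht'.1, hyj.1]
    · linarith [ht'.2]
    · by_cases hk : k = j
      · subst hk; simpa using hj
      · simpa [hk] using hxy k
  have := main ⟨le_rfl, hs⟩ ⟨hs, le_rfl⟩ hs
  simp only [add_zero, update_eq_self] at this
  linarith

lemma hasDerivAt_update_apply {w : ℕ} (z : Fin w → ℝ) (i k : Fin w) :
    HasDerivAt (fun t => update z i t k) (if k = i then 1 else 0) (z i) := by
  by_cases h : k = i
  · subst h; simpa using hasDerivAt_id' (z k)
  · simpa [h] using hasDerivAt_const (z i) (z k)

lemma hasDerivAt_mean_update {w : ℕ} (z : Fin w → ℝ) (i : Fin w) :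
    HasDerivAt (fun t => mean (update z i t)) (1 / w) (z i) := by
  have := (HasDerivAt.fun_sum fun k (_ : k ∈ univ) => hasDerivAt_update_apply z i k).div_const (w : ℝ)
  simpa [mean] using this

lemma hasDerivAt_prod_update {w : ℕ} (s : Finset (Fin w)) (z : Fin w → ℝ) (i : Fin w) :
    HasDerivAt (fun t => ∏ k ∈ s, update z i t k)
      (if i ∈ s then ∏ k ∈ s.erase i, z k else 0) (z i) := by
  by_cases h : i ∈ s
  · have e : ∀ t, ∏ k ∈ s, update z i t k = t * ∏ k ∈ s.erase i, z k := fun t => by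
      rw [prod_update_of_mem h, sdiff_singleton_eq_erase]
    simpa [e, h] using (hasDerivAt_id (z i)).mul_const (∏ k ∈ s.erase i, z k)
  · have e : ∀ t, ∏ k ∈ s, update z i t k = ∏ k ∈ s, z k := fun t => prod_update_of_notMem h z t
    simpa [e, h] using hasDerivAt_const (z i) (∏ k ∈ s, z k)

lemma hasDerivAt_spread_update (z : Fin (n + 2) → ℝ) (i : Fin (n + 2)) :
    HasDerivAt (fun t => spread (update z i t)) (2 * (z i - mean z)) (z i) := by
  have := HasDerivAt.fun_sum fun k (_ : k ∈ univ) =>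
    ((hasDerivAt_update_apply z i k).sub (hasDerivAt_mean_update z i)).pow 2
  refine this.congr_deriv ?_
  have e : ∑ k, (z k - mean z) = 0 := by
    rw [sum_sub_distrib, sum_eq_mean]; simp
  have e' : ∀ k, 2 * (z k - mean z) * ((if k = i then 1 else 0) - 1 / ((n + 2 : ℕ) : ℝ)) =
      (if k = i then 2 * (z k - mean z) else 0) -
        (z k - mean z) * (2 * (1 / ((n + 2 : ℕ) : ℝ))) := fun k => by
    split_ifs <;> ring
  simp only [Pi.sub_apply, update_eq_self, Nat.cast_ofNat, Nat.add_one_sub_one, pow_one, e',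
    sum_sub_distrib (f := fun k => if k = i then 2 * (z k - mean z) else 0), ← sum_mul, e]
  simp

lemma hasDerivAt_mean_pow_update (z : Fin (n + 2) → ℝ) (i : Fin (n + 2)) :
    HasDerivAt (fun t => mean (update z i t) ^ (n + 2)) (mean z ^ (n + 1)) (z i) := by
  refine ((hasDerivAt_mean_update z i).pow (n + 2)).congr_deriv ?_
  rw [update_eq_self]
  push_cast
  field_simp

lemma hasDerivAt_mean_pow_succ_update (z : Fin (n + 2) → ℝ) (i : Fin (n + 2)) :
    HasDerivAt (fun t => mean (update z i t) ^ (n + 1)) ((n + 1) / (n + 2) * mean z ^ n) (z i) := by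
  refine ((hasDerivAt_mean_update z i).pow (n + 1)).congr_deriv ?_
  rw [update_eq_self]
  push_cast
  field_simp

/-- The product of the coordinates, replaced by a power of the average near the diagonal. -/
noncomputable def blend (β : ℝ) (θ : ℝ → ℝ) (z : Fin (n + 2) → ℝ) : ℝ :=
  mean z ^ (n + 2) - β * (θ (spread z) * (mean z ^ (n + 2) - ∏ k, z k))

/-- First partial derivatives of `blend`. -/
noncomputable def blendDeriv (β : ℝ) (θ θ₁ : ℝ → ℝ) (j : Fin (n + 2)) (z : Fin (n + 2) → ℝ) : ℝ :=
  mean z ^ (n + 1) - β * (θ₁ (spread z) * (2 * (z j - mean z)) * (mean z ^ (n + 2) - ∏ k, z k) +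
    θ (spread z) * (mean z ^ (n + 1) - ∏ k ∈ univ.erase j, z k))

/-- Second partial derivatives of `blend`. -/
noncomputable def blendDeriv₂ (β : ℝ) (θ θ₁ θ₂ : ℝ → ℝ) (j i : Fin (n + 2))
    (z : Fin (n + 2) → ℝ) : ℝ :=
  (n + 1) / (n + 2) * mean z ^ n -
    β * (((θ₂ (spread z) * (2 * (z i - mean z))) * (2 * (z j - mean z)) +
          θ₁ (spread z) * (2 * ((if j = i then 1 else 0) - 1 / ((n + 2 : ℕ) : ℝ)))) *
          (mean z ^ (n + 2) - ∏ k, z k) +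
        θ₁ (spread z) * (2 * (z j - mean z)) * (mean z ^ (n + 1) - ∏ k ∈ univ.erase i, z k) +
        (θ₁ (spread z) * (2 * (z i - mean z)) * (mean z ^ (n + 1) - ∏ k ∈ univ.erase j, z k) +
        θ (spread z) * ((n + 1) / (n + 2) * mean z ^ n -
          if i ∈ univ.erase j then ∏ k ∈ (univ.erase j).erase i, z k else 0)))

lemma hasDerivAt_comp_spread_update {θ θ₁ : ℝ → ℝ} (h : ∀ x, HasDerivAt θ (θ₁ x) x)
    (z : Fin (n + 2) → ℝ) (i : Fin (n + 2)) :
    HasDerivAt (fun t => θ (spread (update z i t)))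
      (θ₁ (spread z) * (2 * (z i - mean z))) (z i) := by
  have h' := h (spread (update z i (z i)))
  have := h'.comp (z i) (hasDerivAt_spread_update z i)
  simpa [comp_def] using this

lemma hasDerivAt_gap_update (z : Fin (n + 2) → ℝ) (i : Fin (n + 2)) :
    HasDerivAt (fun t => mean (update z i t) ^ (n + 2) - ∏ k, update z i t k)
      (mean z ^ (n + 1) - ∏ k ∈ univ.erase i, z k) (z i) := by
  simpa using (hasDerivAt_mean_pow_update z i).fun_sub (hasDerivAt_prod_update univ z i)

lemma hasDerivAt_blend (β : ℝ) {θ θ₁ : ℝ → ℝ} (h : ∀ x, HasDerivAt θ (θ₁ x) x)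
    (z : Fin (n + 2) → ℝ) (j : Fin (n + 2)) :
    HasDerivAt (fun t => blend β θ (update z j t)) (blendDeriv β θ θ₁ j z) (z j) := by
  have := (hasDerivAt_mean_pow_update z j).fun_sub
    (((hasDerivAt_comp_spread_update h z j).fun_mul (hasDerivAt_gap_update z j)).const_mul β)
  simp only [update_eq_self] at this
  exact this

lemma hasDerivAt_blendDeriv (β : ℝ) {θ θ₁ θ₂ : ℝ → ℝ} (h : ∀ x, HasDerivAt θ (θ₁ x) x)
    (h' : ∀ x, HasDerivAt θ₁ (θ₂ x) x) (z : Fin (n + 2) → ℝ) (j i : Fin (n + 2)) :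
    HasDerivAt (fun t => blendDeriv β θ θ₁ j (update z i t))
      (blendDeriv₂ β θ θ₁ θ₂ j i z) (z i) := by
  have := (hasDerivAt_mean_pow_succ_update z i).fun_sub
    (((((hasDerivAt_comp_spread_update h' z i).fun_mul
      (((hasDerivAt_update_apply z i j).fun_sub (hasDerivAt_mean_update z i)).const_mul 2)).fun_mul
      (hasDerivAt_gap_update z i)).fun_add
      ((hasDerivAt_comp_spread_update h z i).fun_mul
        ((hasDerivAt_mean_pow_succ_update z i).fun_sub
          (hasDerivAt_prod_update (univ.erase j) z i)))).const_mul β)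
  simp only [update_eq_self] at this
  exact this

lemma blendDeriv₂_nonneg {β κ : ℝ} {θ θ₁ θ₂ : ℝ → ℝ} (hβ : 0 ≤ β)
    (hθ1 : ∀ x, θ x ≤ 1) (hθ0 : ∀ x, 0 ≤ θ x) (h₁ : ∀ x, |θ₁ x * x| ≤ κ)
    (h₂ : ∀ x, |θ₂ x * x ^ 2| ≤ κ)
    (hκ : β * ((4 * n + 14) * κ) ≤ (1 - β) * ((n + 1) / (n + 2)))
    {z : Fin (n + 2) → ℝ} (hz : ∀ k, 0 ≤ z k) (j i : Fin (n + 2)) :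
    0 ≤ blendDeriv₂ β θ θ₁ θ₂ j i z := by
  have hM : 0 ≤ mean z ^ n := pow_nonneg (mean_nonneg hz) n
  have hH0 := prod_le_mean_pow hz
  have hH1 := mean_pow_sub_prod_le hz
  have hHi := abs_mean_pow_sub_prod_erase_le hz i
  have hHj := abs_mean_pow_sub_prod_erase_le hz j
  have hi := abs_sub_mean_le z i
  have hj := abs_sub_mean_le z j
  have hD := spread_nonneg z
  have hd := Real.sqrt_nonneg (spread z)
  have hdd : √(spread z) * √(spread z) = spread z := Real.mul_self_sqrt hD
  have g₁ := h₁ (spread z)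
  have g₂ := h₂ (spread z)
  have hp : 0 ≤ if i ∈ univ.erase j then ∏ k ∈ (univ.erase j).erase i, z k else 0 := by
    split_ifs
    · exact prod_nonneg fun k _ => hz k
    · exact le_rfl
  have hδ : |2 * ((if j = i then (1 : ℝ) else 0) - 1 / ((n + 2 : ℕ) : ℝ))| ≤ 2 := by
    have h0 : 0 ≤ 1 / ((n + 2 : ℕ) : ℝ) := by positivity
    have h1 : 1 / ((n + 2 : ℕ) : ℝ) ≤ 1 := by
      rw [div_le_one (by positivity)]; push_cast; linarith [(Nat.cast_nonneg n : (0 : ℝ) ≤ n)]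
    rw [abs_le]
    split_ifs <;> constructor <;> linarith
  have hθ0' := hθ0 (spread z)
  have hθ1' := hθ1 (spread z)
  unfold blendDeriv₂
  rw [abs_mul, abs_of_nonneg hD] at g₁
  rw [abs_mul, abs_of_nonneg (pow_nonneg hD 2)] at g₂
  have hH : |mean z ^ (n + 2) - ∏ k, z k| ≤ spread z * mean z ^ n := by
    rwa [abs_of_nonneg (sub_nonneg.2 hH0)]
  generalize mean z ^ (n + 2) - ∏ k, z k = H at *
  generalize mean z ^ (n + 1) - ∏ k ∈ univ.erase i, z k = Hi at *
  generalize mean z ^ (n + 1) - ∏ k ∈ univ.erase j, z k = Hj at *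
  generalize (if i ∈ univ.erase j then ∏ k ∈ (univ.erase j).erase i, z k else 0) = p at *
  generalize 2 * ((if j = i then (1 : ℝ) else 0) - 1 / ((n + 2 : ℕ) : ℝ)) = δ at *
  generalize mean z ^ n = M at *
  generalize z i - mean z = zi at *
  generalize z j - mean z = zj at *
  generalize θ (spread z) = T at *
  generalize θ₁ (spread z) = T₁ at *
  generalize θ₂ (spread z) = T₂ at *
  generalize √(spread z) = d at *
  generalize spread z = D at *
  have hn : (0 : ℝ) ≤ n := Nat.cast_nonneg n
  have b1 : |T₂ * (2 * zi) * (2 * zj) * H| ≤ 4 * κ * M := by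
    calc |T₂ * (2 * zi) * (2 * zj) * H| = 4 * |T₂| * (|zi| * |zj|) * |H| := by
          simp only [abs_mul, abs_two]; ring
      _ ≤ 4 * |T₂| * (d * d) * (D * M) := by gcongr
      _ = 4 * (|T₂| * D ^ 2) * M := by rw [hdd]; ring
      _ ≤ 4 * κ * M := by gcongr
  have b2 : |T₁ * δ * H| ≤ 2 * κ * M := by
    calc |T₁ * δ * H| = |T₁| * |δ| * |H| := by simp only [abs_mul]
      _ ≤ |T₁| * 2 * (D * M) := by gcongr
      _ = 2 * (|T₁| * D) * M := by ring
      _ ≤ 2 * κ * M := by gcongr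
  have b3 : ∀ y G : ℝ, |y| ≤ d → |G| ≤ (n + 2) * d * M →
      |T₁ * (2 * y) * G| ≤ 2 * (n + 2) * κ * M := fun y G hy hG => by
    calc |T₁ * (2 * y) * G| = 2 * |T₁| * |y| * |G| := by
          simp only [abs_mul, abs_two]; ring
      _ ≤ 2 * |T₁| * d * ((n + 2) * d * M) := by gcongr
      _ = 2 * (n + 2) * (|T₁| * (d * d)) * M := by ring
      _ = 2 * (n + 2) * (|T₁| * D) * M := by rw [hdd]
      _ ≤ 2 * (n + 2) * κ * M := by gcongr
  have b4 := b3 zj Hi hj hHi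
  have b5 := b3 zi Hj hi hHj
  have b6 : T * ((n + 1) / (n + 2) * M - p) ≤ (n + 1) / (n + 2) * M := by
    have : 0 ≤ (n + 1 : ℝ) / (n + 2) * M := by positivity
    nlinarith [mul_nonneg hθ0' hp]
  have total : (T₂ * (2 * zi) * (2 * zj) + T₁ * δ) * H + T₁ * (2 * zj) * Hi +
      (T₁ * (2 * zi) * Hj + T * ((n + 1) / (n + 2) * M - p)) ≤
      (4 * n + 14) * κ * M + (n + 1) / (n + 2) * M := by
    linarith [le_of_abs_le b1, le_of_abs_le b2, le_of_abs_le b4, le_of_abs_le b5]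
  have h1 := mul_le_mul_of_nonneg_left total hβ
  have h2 := mul_le_mul_of_nonneg_right hκ hM
  linarith

lemma spread_le_of_abs_sub_le {γ : ℝ} (h : ∀ i j, |z i - z j| ≤ γ) :
    spread z ≤ (n + 2) * γ ^ 2 := by
  have hk : ∀ k, |z k - mean z| ≤ γ := fun k => by
    have e : z k - mean z = (∑ l, (z k - z l)) / (n + 2) := by
      rw [sum_sub_distrib, sum_eq_mean (z := z)]
      simp only [sum_const, card_univ, Fintype.card_fin, nsmul_eq_mul]
      push_cast; field_simp
    have hn : (0 : ℝ) < n + 2 := by positivity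
    rw [e, abs_div, abs_of_pos hn, div_le_iff₀ hn]
    refine (abs_sum_le_sum_abs _ _).trans ((sum_le_card_nsmul _ _ _ fun l _ => h k l).trans ?_)
    simp [mul_comm]
  refine (sum_le_card_nsmul univ _ (γ ^ 2) fun k _ => ?_).trans ?_
  · rw [← sq_abs]; exact pow_le_pow_left₀ (abs_nonneg _) (hk k) 2
  · simp

/-- A supermodular extension that agrees with the power of the average near the diagonal and
approximates the product everywhere. -/
lemma exists_supermodular_blend (n : ℕ) {ε : ℝ} (hε : 0 < ε) :
    ∃ Q : (Fin (n + 2) → ℝ) → ℝ,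
      (∀ x y : Fin (n + 2) → ℝ, (∀ k, x k ∈ Set.Icc (0 : ℝ) 1) → (∀ k, y k ∈ Set.Icc (0 : ℝ) 1) →
        (∀ k, x k ≤ y k) → ∀ j, ∀ s : ℝ, 0 ≤ s → y j + s ≤ 1 →
        Q (update x j (x j + s)) - Q x ≤ Q (update y j (y j + s)) - Q y) ∧
      (∀ z : Fin (n + 2) → ℝ, (∀ k, z k ∈ Set.Icc (0 : ℝ) 1) →
        spread z ≤ Real.exp (-(8 * ((n : ℝ) + 2) ^ 6 / ε)) → Q z = mean z ^ (n + 2)) ∧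
      (∀ z : Fin (n + 2) → ℝ, (∀ k, z k ∈ Set.Icc (0 : ℝ) 1) →
        ∏ k, z k ≤ Q z ∧ Q z ≤ ∏ k, z k + ε ∧ Q z ≤ mean z ^ (n + 2)) := by
  have hn : (0 : ℝ) ≤ n := Nat.cast_nonneg n
  have hW : (2 : ℝ) ≤ (n : ℝ) + 2 := by linarith
  set W : ℝ := (n : ℝ) + 2 with hWdef
  set L : ℝ := 8 * W ^ 6 / ε + Real.log (ε / 2) with hLdef
  have hW5 : 32 ≤ W ^ 5 := by
    calc (32 : ℝ) = 2 ^ 5 := by norm_num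
      _ ≤ W ^ 5 := pow_le_pow_left₀ (by norm_num) hW 5
  have hεL : 224 * W ≤ ε * L := by
    have h1 := Real.one_sub_inv_le_log_of_pos (half_pos hε)
    have h2 : ε * (1 - (ε / 2)⁻¹) ≤ ε * Real.log (ε / 2) := mul_le_mul_of_nonneg_left h1 hε.le
    have h3 : ε * (1 - (ε / 2)⁻¹) = ε - 2 := by field_simp
    have h4 : ε * L = 8 * W ^ 6 + ε * Real.log (ε / 2) := by rw [hLdef]; field_simp
    have h5 : 32 * W ≤ W ^ 6 := by
      rw [show W ^ 6 = W ^ 5 * W by ring]; exact mul_le_mul_of_nonneg_right hW5 (by linarith)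
    linarith
  have hL : 0 < L := by
    by_contra h
    have := mul_nonpos_of_nonneg_of_nonpos hε.le (not_lt.1 h)
    linarith
  obtain ⟨θ, θ₁, θ₂, d₁, d₂, hθ0, hθ1, hnear, hfar, b₁, b₂⟩ :=
    exists_log_cutoff (Real.exp_pos (-(8 * W ^ 6 / ε))) hL
  have hend : Real.exp (-(8 * W ^ 6 / ε)) * Real.exp L = ε / 2 := by
    rw [← Real.exp_add, hLdef, neg_add_cancel_left, Real.exp_log (half_pos hε)]
  rw [hend] at hfar
  set β : ℝ := max 0 (1 - ε / 2) with hβdef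
  have hβ0 : 0 ≤ β := le_max_left _ _
  have hβ1 : β ≤ 1 := max_le zero_le_one (by linarith)
  have hβε : 1 - β ≤ ε / 2 := by linarith [le_max_right 0 (1 - ε / 2)]
  have hκ : β * ((4 * n + 14) * (15 / L ^ 2 + 2 / L)) ≤ (1 - β) * ((n + 1) / (n + 2)) := by
    rcases le_or_gt 2 ε with h | h
    · have : β = 0 := max_eq_left (by linarith)
      rw [this]; simp; positivity
    · have hβ : β = 1 - ε / 2 := max_eq_right (by linarith)
      have hr : 0 < 1 / L := by positivity
      have hWr : W * (1 / L) ≤ ε / 224 := by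
        rw [mul_one_div, div_le_iff₀ hL]; linarith
      have hr1 : 1 / L ≤ 1 / 200 := by nlinarith
      have e : 15 / L ^ 2 + 2 / L = 15 * (1 / L) * (1 / L) + 2 * (1 / L) := by field_simp
      have h1 : 15 / L ^ 2 + 2 / L ≤ 3 * (1 / L) := by rw [e]; nlinarith
      have h2 : (4 * n + 14) * (15 / L ^ 2 + 2 / L) ≤ ε / 4 := by
        calc (4 * (n : ℝ) + 14) * (15 / L ^ 2 + 2 / L) ≤ (7 * W) * (3 * (1 / L)) := by
              apply mul_le_mul _ h1 (by positivity) (by linarith)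
              rw [hWdef]; linarith
          _ = 21 * (W * (1 / L)) := by ring
          _ ≤ ε / 4 := by linarith
      have h3 : (1 : ℝ) / 2 ≤ (n + 1) / (n + 2) := by
        rw [div_le_div_iff₀ (by norm_num) (by positivity)]; linarith
      calc β * ((4 * n + 14) * (15 / L ^ 2 + 2 / L)) ≤ 1 * (ε / 4) :=
            mul_le_mul hβ1 h2 (by positivity) zero_le_one
        _ = (1 - β) * (1 / 2) := by rw [hβ]; ring
        _ ≤ _ := mul_le_mul_of_nonneg_left h3 (by linarith)
  refine ⟨blend β θ, fun x y hx hy hxy j s hs hys => ?_, fun z hz hsp => ?_, fun z hz => ?_⟩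
  · refine sub_le_sub_of_second_partials_nonneg (fun z j => hasDerivAt_blend β d₁ z j)
      (fun z j i => hasDerivAt_blendDeriv β d₁ d₂ z j i) (fun z hz j i => ?_) hx hy hxy j hs hys
    refine blendDeriv₂_nonneg hβ0 hθ1 hθ0 (fun x => (b₁ x).trans ?_) b₂ hκ (fun k => (hz k).1) j i
    exact le_add_of_nonneg_left (by positivity)
  · simp [blend, hnear _ (spread_nonneg z) hsp]
  · have hz0 : ∀ k, 0 ≤ z k := fun k => (hz k).1
    have hG := prod_le_mean_pow hz0
    have hH := mean_pow_sub_prod_le hz0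
    have hP : 0 ≤ ∏ k, z k := prod_nonneg fun k _ => hz0 k
    have hm0 := mean_nonneg hz0
    have hm1 : mean z ≤ 1 := by
      have := sum_le_card_nsmul univ z 1 fun k _ => (hz k).2
      rw [sum_eq_mean] at this
      simp only [card_univ, Fintype.card_fin, nsmul_eq_mul, mul_one] at this
      push_cast at this
      nlinarith
    have hmn : mean z ^ n ≤ 1 := pow_le_one₀ hm0 hm1
    have hmn' : mean z ^ (n + 2) ≤ 1 := pow_le_one₀ hm0 hm1
    have hD := spread_nonneg z
    have t0 := hθ0 (spread z)
    have t1 := hθ1 (spread z)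
    have hfar' : (1 - θ (spread z)) * (mean z ^ (n + 2) - ∏ k, z k) ≤ ε / 2 := by
      rcases le_or_gt (ε / 2) (spread z) with h | h
      · rw [hfar _ h]; linarith
      · have : mean z ^ (n + 2) - ∏ k, z k ≤ spread z := hH.trans (mul_le_of_le_one_right hD hmn)
        nlinarith
    have e : blend β θ z = ∏ k, z k + (1 - β) * (mean z ^ (n + 2) - ∏ k, z k) +
        β * ((1 - θ (spread z)) * (mean z ^ (n + 2) - ∏ k, z k)) := by
      rw [blend]; ring
    have e' : blend β θ z = mean z ^ (n + 2) -
        β * (θ (spread z) * (mean z ^ (n + 2) - ∏ k, z k)) := rfl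
    have hH0 : 0 ≤ mean z ^ (n + 2) - ∏ k, z k := sub_nonneg.2 hG
    have hH1 : mean z ^ (n + 2) - ∏ k, z k ≤ 1 := by linarith
    have p1 : 0 ≤ (1 - β) * (mean z ^ (n + 2) - ∏ k, z k) := mul_nonneg (by linarith) hH0
    have p2 : 0 ≤ (1 - θ (spread z)) * (mean z ^ (n + 2) - ∏ k, z k) :=
      mul_nonneg (by linarith) hH0
    refine ⟨?_, ?_, ?_⟩
    · rw [e]; linarith [mul_nonneg hβ0 p2]
    · rw [e]
      have q1 : (1 - β) * (mean z ^ (n + 2) - ∏ k, z k) ≤ ε / 2 :=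
        (mul_le_of_le_one_right (by linarith) hH1).trans hβε
      have q2 := (mul_le_of_le_one_left p2 hβ1).trans hfar'
      linarith
    · rw [e']; linarith [mul_nonneg hβ0 (mul_nonneg t0 hH0)]

end

/-- For every positive integer `w` and `ε > 0`, with
`γ = w⁻¹ · exp(−4w⁶/ε)`, there exists `f̂ : [0,1]^w → [0,1]` that is monotone and
DR-submodular on the box, agrees with the symmetric function
`g(x) = 1 − (1 − x̄)^w` whenever all coordinates are within `γ` of each other,
and satisfies `f(x) − ε ≤ f̂(x) ≤ f(x)` where `f(x) = 1 − ∏ (1 − xᵢ)`. -/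
theorem stmt_0 (w : ℕ) (hw : 0 < w) (ε : ℝ) (hε : 0 < ε) :
    ∃ fhat : (Fin w → ℝ) → ℝ,
      -- f̂ takes values in [0,1]
      (∀ x : Fin w → ℝ, (∀ i, x i ∈ Set.Icc (0:ℝ) 1) → fhat x ∈ Set.Icc (0:ℝ) 1) ∧
      -- monotone on [0,1]^w
      (∀ x y : Fin w → ℝ, (∀ i, x i ∈ Set.Icc (0:ℝ) 1) → (∀ i, y i ∈ Set.Icc (0:ℝ) 1) →
        (∀ i, x i ≤ y i) → fhat x ≤ fhat y) ∧
      -- DR-submodular on [0,1]^w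
      (∀ x y : Fin w → ℝ, (∀ i, x i ∈ Set.Icc (0:ℝ) 1) → (∀ i, y i ∈ Set.Icc (0:ℝ) 1) →
        (∀ i, x i ≤ y i) → ∀ j : Fin w, ∀ s : ℝ, 0 ≤ s → y j + s ≤ 1 →
          fhat (Function.update y j (y j + s)) - fhat y ≤
            fhat (Function.update x j (x j + s)) - fhat x) ∧
      -- (1) f̂ = g on γ-balanced points
      (∀ x : Fin w → ℝ, (∀ i, x i ∈ Set.Icc (0:ℝ) 1) →
        (∀ i j, |x i - x j| ≤ ((w : ℝ))⁻¹ * Real.exp (-(4 * (w : ℝ) ^ 6) / ε)) →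
        fhat x = 1 - (1 - (∑ i, x i) / w) ^ w) ∧
      -- (2) f − ε ≤ f̂ ≤ f
      (∀ x : Fin w → ℝ, (∀ i, x i ∈ Set.Icc (0:ℝ) 1) →
        (1 - ∏ i, (1 - x i)) - ε ≤ fhat x ∧ fhat x ≤ 1 - ∏ i, (1 - x i)) := by
  obtain ⟨w, rfl⟩ : ∃ m, w = m + 1 := ⟨w - 1, by omega⟩
  rcases w with _ | n
  · refine ⟨fun x => x 0, fun x hx => hx 0, fun x y _ _ h => h 0, fun x y _ _ _ j s _ _ => ?_,
      fun x _ _ => by simp, fun x _ => ?_⟩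
    · obtain rfl : j = 0 := Fin.fin_one_eq_zero j
      simp
    · simp [hε.le]
  · obtain ⟨Q, hDR, hdiag, happ⟩ := exists_supermodular_blend n hε
    have box : ∀ x : Fin (n + 2) → ℝ, (∀ i, x i ∈ Set.Icc (0 : ℝ) 1) →
        ∀ i, 1 - x i ∈ Set.Icc (0 : ℝ) 1 := fun x hx i =>
      ⟨by linarith [(hx i).2], by linarith [(hx i).1]⟩
    have dr : ∀ x y : Fin (n + 2) → ℝ, (∀ i, x i ∈ Set.Icc (0 : ℝ) 1) →
        (∀ i, y i ∈ Set.Icc (0 : ℝ) 1) → (∀ i, x i ≤ y i) → ∀ j, ∀ s : ℝ, 0 ≤ s → y j + s ≤ 1 →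
        Q (fun i => 1 - y i) - Q (fun i => 1 - update y j (y j + s) i) ≤
          Q (fun i => 1 - x i) - Q (fun i => 1 - update x j (x j + s) i) := by
      intro x y hx hy hxy j s hs hys
      have upd : ∀ z : Fin (n + 2) → ℝ, (∀ i, z i ∈ Set.Icc (0 : ℝ) 1) → z j + s ≤ 1 →
          ∀ i, update z j (z j + s) i ∈ Set.Icc (0 : ℝ) 1 := fun z hz h i => by
        by_cases hi : i = j
        · subst hi
          rw [update_self]
          exact ⟨add_nonneg (hz i).1 hs, h⟩
        · simpa [hi] using hz i
      have back : ∀ z : Fin (n + 2) → ℝ, update (fun i => 1 - update z j (z j + s) i) j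
          (1 - update z j (z j + s) j + s) = fun i => 1 - z i := fun z => by
        funext i
        by_cases hi : i = j
        · subst hi; simp only [update_self]; ring
        · simp [hi]
      have := hDR (fun i => 1 - update y j (y j + s) i) (fun i => 1 - update x j (x j + s) i)
        (box _ (upd y hy hys)) (box _ (upd x hx (by linarith [hxy j]))) (fun i => ?_) j s hs ?_
      · rwa [back, back] at this
      · by_cases hi : i = j
        · subst hi; simp only [update_self]; linarith [hxy i]
        · simp only [update_of_ne hi]; linarith [hxy i]
      · simp only [update_self]; linarith [(hx j).1]
    have range : ∀ z : Fin (n + 2) → ℝ, (∀ i, z i ∈ Set.Icc (0 : ℝ) 1) → 0 ≤ Q z := fun z hz =>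
      (prod_nonneg fun i _ => (hz i).1).trans (happ z hz).1
    have zero : Q 0 = 0 := by
      have h := happ 0 fun _ => ⟨le_rfl, zero_le_one⟩
      refine le_antisymm (h.2.2.trans ?_) (range _ fun _ => ⟨le_rfl, zero_le_one⟩)
      simp [mean]
    have incr : ∀ z : Fin (n + 2) → ℝ, (∀ i, z i ∈ Set.Icc (0 : ℝ) 1) → ∀ i,
        MonotoneOn (fun t => Q (update z i t)) (Set.Icc 0 1) := by
      intro z hz i s hs t ht hst
      have hb : ∀ k, update z i s k ∈ Set.Icc (0 : ℝ) 1 := fun k => by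
        by_cases hk : k = i
        · subst hk; simpa using hs
        · simpa [hk] using hz k
      have := hDR 0 (update z i s) (fun _ => ⟨le_rfl, zero_le_one⟩) hb (fun k => (hb k).1) i
        (t - s) (by linarith) (by simpa using ht.2)
      simp only [zero, update_self, update_idem, add_sub_cancel] at this
      have h0 : 0 ≤ Q (update 0 i ((0 : Fin (n + 2) → ℝ) i + (t - s))) := range _ fun k => by
        by_cases hk : k = i
        · subst hk
          simp only [update_self, Pi.zero_apply, zero_add]
          exact ⟨by linarith, by linarith [hs.1, ht.2]⟩
        · simp [hk]
      change Q (update z i s) ≤ Q (update z i t)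
      linarith
    have mono : ∀ x y : Fin (n + 2) → ℝ, (∀ i, x i ∈ Set.Icc (0 : ℝ) 1) →
        (∀ i, y i ∈ Set.Icc (0 : ℝ) 1) → (∀ i, x i ≤ y i) → Q x ≤ Q y := fun x y hx hy hxy =>
      le_of_forall_update_monotone incr hx hy hxy
    refine ⟨fun x => 1 - Q (fun i => 1 - x i), fun x hx => ?_, fun x y hx hy hxy => ?_,
      fun x y hx hy hxy j s hs hys => ?_, fun x hx hbal => ?_, fun x hx => ?_⟩
    · have h0 := range _ (box x hx)
      have h1 : Q (fun i => 1 - x i) ≤ Q (fun _ => 1) :=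
        mono _ _ (box x hx) (fun _ => ⟨zero_le_one, le_rfl⟩) fun i => (box x hx i).2
      have h2 := (happ (fun _ => 1) fun _ => ⟨zero_le_one, le_rfl⟩).2.2
      have h3 : mean (fun _ : Fin (n + 2) => (1 : ℝ)) = 1 := by
        unfold mean; simp only [sum_const, card_univ, Fintype.card_fin, nsmul_eq_mul, mul_one]
        exact div_self (by positivity)
      rw [h3, one_pow] at h2
      exact ⟨by linarith, by linarith⟩
    · have := mono _ _ (box y hy) (box x hx) fun i => sub_le_sub_left (hxy i) 1
      exact sub_le_sub_left this 1
    · have := dr x y hx hy hxy j s hs hys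
      simp only
      linarith
    · have hmean : mean (fun i => 1 - x i) = 1 - (∑ i, x i) / ((n + 1 + 1 : ℕ) : ℝ) := by
        unfold mean
        rw [sum_sub_distrib, sub_div]
        simp only [sum_const, card_univ, Fintype.card_fin, nsmul_eq_mul, mul_one]
        rw [div_self (by positivity)]
      have hsp := spread_le_of_abs_sub_le (z := fun i => 1 - x i) fun i j => by
        have := hbal j i
        rwa [show (1 - x i) - (1 - x j) = x j - x i by ring]
      simp only
      rw [hdiag _ (box x hx) (hsp.trans ?_), hmean]
      have hc : ((n + 1 + 1 : ℕ) : ℝ) = (n : ℝ) + 2 := by push_cast; ring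
      have hn : (1 : ℝ) ≤ (n : ℝ) + 2 := by linarith [(Nat.cast_nonneg n : (0 : ℝ) ≤ n)]
      rw [hc, mul_pow, ← Real.exp_nat_mul]
      have he : ((2 : ℕ) : ℝ) * (-(4 * ((n : ℝ) + 2) ^ 6) / ε) = -(8 * ((n : ℝ) + 2) ^ 6 / ε) := by
        push_cast; ring
      rw [he, ← mul_assoc]
      refine mul_le_of_le_one_left (Real.exp_pos _).le ?_
      rw [show ((n : ℝ) + 2) * ((n : ℝ) + 2)⁻¹ ^ 2 = ((n : ℝ) + 2)⁻¹ by field_simp]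
      exact inv_le_one_of_one_le₀ hn
    · obtain ⟨h1, h2, -⟩ := happ _ (box x hx)
      exact ⟨by linarith, by linarith⟩
end

section
/- Let w, m be positive integers, let f̂ : [0,1]^w → [0,1] be monotone and DR-submodular, and define F̂ : ([0,1]^w)^m → ℝ by F̂(x_1,…,x_m) = 1 − ∏_{i=1}^m (1 − f̂(x_i)). Then: (1) F̂ is monotone, DR-submodular, and takes values in [0,1]; (2) if γ > 0 and f̂(y) = 1 − (1 − ȳ)^w for every y ∈ [0,1]^w with max_{j,j'} |y_j − y_{j'}| ≤ γ, then F̂(x) = 1 − ∏_{i=1}^m (1 − x̄_i)^w for every x with max_{j,j'} |x_{i,j} − x_{i,j'}| ≤ γ for all i ∈ [m] (in particular F̂(x) then depends only on the block averages x̄_1,…,x̄_m); and (3) if ε > 0 and f̂(y) ≥ 1 − ∏_{j=1}^w (1 − y_j) − ε for all y ∈ [0,1]^w, then F̂(x) ≥ 1 − ε whenever some coordinate x_{i,j} = 1. -/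
/-- Changing one coordinate of a block vector changes `1 - ∏ i, (1 - f (x i))` by the change of `f`
on the affected block times the product over the other blocks. -/
theorem one_sub_prod_update_sub {ι κ : Type*} [Fintype ι] [DecidableEq ι] [DecidableEq κ]
    (f : (κ → ℝ) → ℝ) (x : ι × κ → ℝ) (i₀ : ι) (j₀ : κ) (t : ℝ) :
    (1 - ∏ i, (1 - f (fun j => Function.update x (i₀, j₀) t (i, j)))) -
        (1 - ∏ i, (1 - f (fun j => x (i, j)))) =
      (f (Function.update (fun j => x (i₀, j)) j₀ t) - f (fun j => x (i₀, j))) *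
        ∏ i ∈ Finset.univ.erase i₀, (1 - f (fun j => x (i, j))) := by
  have hblock : (fun j => Function.update x (i₀, j₀) t (i₀, j)) =
      Function.update (fun j => x (i₀, j)) j₀ t := by
    ext j
    simp [Function.update_apply]
  have hrest : ∏ i ∈ Finset.univ.erase i₀,
      (1 - f (fun j => Function.update x (i₀, j₀) t (i, j))) =
        ∏ i ∈ Finset.univ.erase i₀, (1 - f (fun j => x (i, j))) := by
    refine Finset.prod_congr rfl fun i hi => ?_
    simp [Finset.ne_of_mem_erase hi]
  rw [← Finset.mul_prod_erase Finset.univ _ (Finset.mem_univ i₀),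
    ← Finset.mul_prod_erase Finset.univ (fun i => 1 - f (fun j => x (i, j)))
      (Finset.mem_univ i₀), hblock, hrest]
  ring

/-- If `f̂ : [0,1]^w → [0,1]` is monotone and DR-submodular, then
`F̂(x₁,…,x_m) = 1 − ∏ᵢ (1 − f̂(xᵢ))` is monotone, DR-submodular and in `[0,1]`;
it equals `1 − ∏ᵢ (1 − x̄ᵢ)^w` on blockwise γ-balanced points whenever `f̂`
equals the symmetric function on γ-balanced points; and `F̂(x) ≥ 1 − ε` whenever
some coordinate equals 1, provided `f̂(y) ≥ 1 − ∏ⱼ(1 − yⱼ) − ε`. -/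
theorem stmt_1 (w m : ℕ) (hw : 0 < w) (hm : 0 < m)
    (fhat : (Fin w → ℝ) → ℝ)
    (hrange : ∀ y : Fin w → ℝ, (∀ j, y j ∈ Set.Icc (0:ℝ) 1) → fhat y ∈ Set.Icc (0:ℝ) 1)
    (hmono : ∀ y z : Fin w → ℝ, (∀ j, y j ∈ Set.Icc (0:ℝ) 1) → (∀ j, z j ∈ Set.Icc (0:ℝ) 1) →
      (∀ j, y j ≤ z j) → fhat y ≤ fhat z)
    (hDR : ∀ y z : Fin w → ℝ, (∀ j, y j ∈ Set.Icc (0:ℝ) 1) → (∀ j, z j ∈ Set.Icc (0:ℝ) 1) →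
      (∀ j, y j ≤ z j) → ∀ j : Fin w, ∀ s : ℝ, 0 ≤ s → z j + s ≤ 1 →
        fhat (Function.update z j (z j + s)) - fhat z ≤
          fhat (Function.update y j (y j + s)) - fhat y) :
    -- (1a) F̂ takes values in [0,1]
    (∀ x : Fin m × Fin w → ℝ, (∀ p, x p ∈ Set.Icc (0:ℝ) 1) →
      (1 - ∏ i : Fin m, (1 - fhat (fun j => x (i, j)))) ∈ Set.Icc (0:ℝ) 1) ∧
    -- (1b) F̂ is monotone
    (∀ x y : Fin m × Fin w → ℝ, (∀ p, x p ∈ Set.Icc (0:ℝ) 1) →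
      (∀ p, y p ∈ Set.Icc (0:ℝ) 1) → (∀ p, x p ≤ y p) →
      (1 - ∏ i : Fin m, (1 - fhat (fun j => x (i, j)))) ≤
        (1 - ∏ i : Fin m, (1 - fhat (fun j => y (i, j))))) ∧
    -- (1c) F̂ is DR-submodular
    (∀ x y : Fin m × Fin w → ℝ, (∀ p, x p ∈ Set.Icc (0:ℝ) 1) →
      (∀ p, y p ∈ Set.Icc (0:ℝ) 1) → (∀ p, x p ≤ y p) →
      ∀ p : Fin m × Fin w, ∀ s : ℝ, 0 ≤ s → y p + s ≤ 1 →
      (1 - ∏ i : Fin m, (1 - fhat (fun j => Function.update y p (y p + s) (i, j)))) -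
          (1 - ∏ i : Fin m, (1 - fhat (fun j => y (i, j)))) ≤
        (1 - ∏ i : Fin m, (1 - fhat (fun j => Function.update x p (x p + s) (i, j)))) -
          (1 - ∏ i : Fin m, (1 - fhat (fun j => x (i, j))))) ∧
    -- (2) symmetric form on blockwise balanced points
    (∀ γ : ℝ, 0 < γ →
      (∀ y : Fin w → ℝ, (∀ j, y j ∈ Set.Icc (0:ℝ) 1) →
        (∀ j j', |y j - y j'| ≤ γ) → fhat y = 1 - (1 - (∑ j, y j) / w) ^ w) →
      ∀ x : Fin m × Fin w → ℝ, (∀ p, x p ∈ Set.Icc (0:ℝ) 1) →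
        (∀ (i : Fin m) (j j' : Fin w), |x (i, j) - x (i, j')| ≤ γ) →
        (1 - ∏ i : Fin m, (1 - fhat (fun j => x (i, j)))) =
          1 - ∏ i : Fin m, (1 - (∑ j, x (i, j)) / w) ^ w) ∧
    -- (3) F̂ ≥ 1 − ε when some coordinate is 1
    (∀ ε : ℝ, 0 < ε →
      (∀ y : Fin w → ℝ, (∀ j, y j ∈ Set.Icc (0:ℝ) 1) →
        1 - ∏ j, (1 - y j) - ε ≤ fhat y) →
      ∀ x : Fin m × Fin w → ℝ, (∀ p, x p ∈ Set.Icc (0:ℝ) 1) →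
        (∃ p, x p = 1) →
        1 - ε ≤ 1 - ∏ i : Fin m, (1 - fhat (fun j => x (i, j)))) := by
  have hnonneg : ∀ x : Fin m × Fin w → ℝ, (∀ p, x p ∈ Set.Icc (0:ℝ) 1) → ∀ i,
      0 ≤ 1 - fhat (fun j => x (i, j)) := fun x hx i =>
    sub_nonneg.2 (hrange _ fun j => hx (i, j)).2
  have hle_one : ∀ x : Fin m × Fin w → ℝ, (∀ p, x p ∈ Set.Icc (0:ℝ) 1) → ∀ i,
      1 - fhat (fun j => x (i, j)) ≤ 1 := fun x hx i =>
    sub_le_self _ (hrange _ fun j => hx (i, j)).1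
  have hanti : ∀ x y : Fin m × Fin w → ℝ, (∀ p, x p ∈ Set.Icc (0:ℝ) 1) →
      (∀ p, y p ∈ Set.Icc (0:ℝ) 1) → (∀ p, x p ≤ y p) → ∀ i,
      1 - fhat (fun j => y (i, j)) ≤ 1 - fhat (fun j => x (i, j)) := fun x y hx hy hxy i =>
    sub_le_sub_left (hmono _ _ (fun j => hx (i, j)) (fun j => hy (i, j)) fun j => hxy (i, j)) 1
  refine ⟨fun x hx => ⟨?_, ?_⟩, fun x y hx hy hxy => ?_, ?_, fun γ _ hf x hx hbal => ?_, ?_⟩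
  · exact sub_nonneg.2 (Finset.prod_le_one (fun i _ => hnonneg x hx i) fun i _ => hle_one x hx i)
  · exact sub_le_self _ (Finset.prod_nonneg fun i _ => hnonneg x hx i)
  · exact sub_le_sub_left
      (Finset.prod_le_prod (fun i _ => hnonneg y hy i) fun i _ => hanti x y hx hy hxy i) 1
  · rintro x y hx hy hxy ⟨i₀, j₀⟩ s hs hys
    rw [one_sub_prod_update_sub, one_sub_prod_update_sub]
    have hxs : x (i₀, j₀) + s ≤ 1 := by linarith [hxy (i₀, j₀)]
    refine mul_le_mul
      (hDR _ _ (fun j => hx (i₀, j)) (fun j => hy (i₀, j)) (fun j => hxy (i₀, j)) j₀ s hs hys)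
      (Finset.prod_le_prod (fun i _ => hnonneg y hy i) fun i _ => hanti x y hx hy hxy i)
      (Finset.prod_nonneg fun i _ => hnonneg y hy i)
      (sub_nonneg.2 (hmono _ _ (fun j => hx (i₀, j)) (fun j => ?_) fun j => ?_))
    · rcases eq_or_ne j j₀ with rfl | hj
      · simpa using ⟨add_nonneg (hx (i₀, j)).1 hs, hxs⟩
      · simpa [hj] using hx (i₀, j)
    · rcases eq_or_ne j j₀ with rfl | hj
      · simpa using hs
      · simp [hj]
  · refine congrArg (1 - ·) (Finset.prod_congr rfl fun i _ => ?_)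
    rw [hf _ (fun j => hx (i, j)) (hbal i), sub_sub_cancel]
  · rintro ε - hf x hx ⟨⟨i₀, j₀⟩, hp⟩
    have hzero : ∏ j, (1 - x (i₀, j)) = 0 :=
      Finset.prod_eq_zero (Finset.mem_univ j₀) (by rw [hp, sub_self])
    have hblock := hf _ fun j => hx (i₀, j)
    rw [hzero] at hblock
    have hprod : ∏ i, (1 - fhat (fun j => x (i, j))) ≤ 1 - fhat (fun j => x (i₀, j)) := by
      rw [← Finset.mul_prod_erase Finset.univ _ (Finset.mem_univ i₀)]
      exact mul_le_of_le_one_right (hnonneg x hx i₀)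
        (Finset.prod_le_one (fun i _ => hnonneg x hx i) fun i _ => hle_one x hx i)
    linarith
end

section
/- Let S ⊆ V and let π, π′ : [m] → [m] be two bijections such that for every i ∈ [m], π(i) = π′(i) holds whenever (1) S ∩ B_i ≠ ∅ and (2) either S ∩ A_{π(i)} ≠ ∅ or S ∩ A_{π′(i)} ≠ ∅. Then G_π(S) = G_{π′}(S). -/
/-- A sum over subsets weighted by the binomial weights `β ^ |I| (1 - β) ^ (n - |I|)` of one minus
a product of independent choices factors as one minus a product. -/
lemma sum_binomial_weight_one_sub_prod {ι R : Type*} [Fintype ι] [DecidableEq ι] [CommRing R]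
    (β : R) (a b : ι → R) :
    ∑ I : Finset ι, β ^ I.card * (1 - β) ^ (Fintype.card ι - I.card) *
        (1 - (∏ i ∈ I, a i) * ∏ i ∈ Iᶜ, b i)
      = 1 - ∏ i, (β * a i + (1 - β) * b i) := by
  have h_one : ∑ I : Finset ι, β ^ I.card * (1 - β) ^ (Fintype.card ι - I.card) = 1 := by
    rw [Fintype.sum_pow_mul_eq_add_pow, add_sub_cancel, one_pow]
  rw [Finset.prod_add, Finset.powerset_univ]
  simp only [mul_sub, mul_one, Finset.sum_sub_distrib, h_one]
  congr 1
  refine Finset.sum_congr rfl fun I _ => ?_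
  rw [Finset.prod_mul_distrib, Finset.prod_mul_distrib, Finset.prod_const, Finset.prod_const,
    ← Finset.compl_eq_univ_sdiff, Finset.card_compl]
  ring

/-- Two permutations that give the same factor wherever `b i ≠ 1` give the same product of
mixtures `β a (π i) + (1 - β) b i`. -/
lemma prod_mix_perm_congr {ι R : Type*} [Fintype ι] [CommRing R] [IsDomain R]
    (β : R) (a b : ι → R) (π π' : Equiv.Perm ι)
    (hne : ∀ j, β * a j + (1 - β) ≠ 0) (h : ∀ i, b i ≠ 1 → a (π i) = a (π' i)) :
    ∏ i, (β * a (π i) + (1 - β) * b i) = ∏ i, (β * a (π' i) + (1 - β) * b i) := by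
  have hmul : (∏ i, (β * a (π i) + (1 - β) * b i)) * ∏ i, (β * a (π' i) + (1 - β))
      = (∏ i, (β * a (π' i) + (1 - β) * b i)) * ∏ i, (β * a (π i) + (1 - β)) := by
    rw [← Finset.prod_mul_distrib, ← Finset.prod_mul_distrib]
    refine Finset.prod_congr rfl fun i _ => ?_
    by_cases hb : b i = 1
    · rw [hb]; ring
    · rw [h i hb]
  rw [Equiv.prod_comp π fun j => β * a j + (1 - β),
    Equiv.prod_comp π' fun j => β * a j + (1 - β)] at hmul
  exact mul_right_cancel₀ (Finset.prod_ne_zero_iff.2 fun j _ => hne j) hmul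


/-- The function `G_π` from the linear lower bound construction. -/
noncomputable def Gfun {V : Type*} [DecidableEq V] (m k w : ℕ) (ε α β : ℝ)
    (A B : Fin m → Finset V) (π : Equiv.Perm (Fin m)) (S : Finset V) : ℝ :=
  min
    (∑ I : Finset (Fin m), β ^ I.card * (1 - β) ^ (m - I.card) *
        (1 - (∏ i ∈ I, (1 - ((S ∩ A (π i)).card : ℝ) / (α * k * w)) ^ w) *
          ∏ i ∈ Iᶜ, (1 - ((S ∩ B i).card : ℝ) / ((1 - α) * k * w)) ^ w)
      + (ε / k) * S.card)
    1

/-- If `π, π'` agree on every `i` with `S ∩ B_i ≠ ∅` and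
`S ∩ A_{π(i)} ≠ ∅` or `S ∩ A_{π'(i)} ≠ ∅`, then `G_π(S) = G_{π'}(S)`. -/
theorem stmt_3 {V : Type*} [DecidableEq V] (m k w : ℕ)
    (hm : 0 < m) (hk : 0 < k) (hw : 0 < w)
    (ε : ℝ) (hε : 0 < ε) (α β : ℝ)
    (hα : α ∈ Set.Ioo (0:ℝ) 1) (hβ : β ∈ Set.Ioo (0:ℝ) 1)
    (A B : Fin m → Finset V)
    (hcardA : ∀ i, ((A i).card : ℝ) = α * k * w)
    (hcardB : ∀ i, ((B i).card : ℝ) = (1 - α) * k * w)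
    (hAA : ∀ i j, i ≠ j → Disjoint (A i) (A j))
    (hBB : ∀ i j, i ≠ j → Disjoint (B i) (B j))
    (hAB : ∀ i j, Disjoint (A i) (B j))
    (S : Finset V) (π π' : Equiv.Perm (Fin m))
    (hcond : ∀ i : Fin m, (S ∩ B i).Nonempty →
      ((S ∩ A (π i)).Nonempty ∨ (S ∩ A (π' i)).Nonempty) → π i = π' i) :
    Gfun m k w ε α β A B π S = Gfun m k w ε α β A B π' S := by
  have hk' : (0 : ℝ) < k := Nat.cast_pos.2 hk
  have hw' : (0 : ℝ) < w := Nat.cast_pos.2 hw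
  have hden : 0 < α * k * w := mul_pos (mul_pos hα.1 hk') hw'
  have hsum := fun σ : Equiv.Perm (Fin m) => sum_binomial_weight_one_sub_prod β
    (fun i => (1 - ((S ∩ A (σ i)).card : ℝ) / (α * k * w)) ^ w)
    (fun i => (1 - ((S ∩ B i).card : ℝ) / ((1 - α) * k * w)) ^ w)
  simp only [Fintype.card_fin] at hsum
  unfold Gfun
  rw [hsum π, hsum π', prod_mix_perm_congr β
    (fun j => (1 - ((S ∩ A j).card : ℝ) / (α * k * w)) ^ w) _ π π']
  · intro j
    have hle : ((S ∩ A j).card : ℝ) / (α * k * w) ≤ 1 := by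
      rw [div_le_one hden, ← hcardA j]
      exact_mod_cast Finset.card_le_card Finset.inter_subset_right
    exact (add_pos_of_nonneg_of_pos
      (mul_nonneg hβ.1.le (pow_nonneg (sub_nonneg.2 hle) w)) (sub_pos.2 hβ.2)).ne'
  · intro i hb
    have hB : (S ∩ B i).Nonempty := by
      by_contra hempty
      exact hb (by simp [Finset.not_nonempty_iff_eq_empty.1 hempty])
    by_cases hA : (S ∩ A (π i)).Nonempty ∨ (S ∩ A (π' i)).Nonempty
    · rw [hcond i hB hA]
    · simp only [not_or, Finset.not_nonempty_iff_eq_empty] at hA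
      simp only [hA.1, hA.2]
end

section
/- Let α = 0.56 and β = 0.42. Then for every λ ∈ [0,1], β·(1 − exp(−(1−λ)β/α)) + (1−β)·(1 − exp(−(1−λ)β/α)·exp(−λ/(1−α))) ≤ 0.5839. -/
/-- Lower bound for `Real.exp` by its Taylor polynomial of degree nine on `[-1, 1]`. -/
theorem taylor_sub_le_exp {x : ℝ} (hx : |x| ≤ 1) :
    1 + x + x ^ 2 / 2 + x ^ 3 / 6 + x ^ 4 / 24 + x ^ 5 / 120 + x ^ 6 / 720 + x ^ 7 / 5040
      + x ^ 8 / 40320 + x ^ 9 / 362880 - |x| ^ 10 * (11 / 36288000) ≤ Real.exp x := by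
  have h := (abs_le.mp (Real.exp_bound hx (n := 10) (by norm_num))).1
  norm_num [Finset.sum_range_succ, Nat.factorial] at h
  linarith

/-- The tangent line of `Real.exp` at `x₀`, scaled down to a slope `a ≤ exp x₀`, stays below
`Real.exp` where it is nonnegative. -/
theorem mul_add_one_sub_le_exp {a x x₀ : ℝ} (ha : a ≤ Real.exp x₀) (hx : 0 ≤ x - x₀ + 1) :
    a * (x - x₀ + 1) ≤ Real.exp x :=
  calc a * (x - x₀ + 1) ≤ Real.exp x₀ * Real.exp (x - x₀) :=
        mul_le_mul ha (Real.add_one_le_exp _) hx (Real.exp_pos _).le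
    _ = Real.exp x := by rw [← Real.exp_add, add_sub_cancel]

/-- With `α = 0.56` and `β = 0.42`, for every `λ ∈ [0,1]`,
`β·(1 − e^{−(1−λ)β/α}) + (1−β)·(1 − e^{−(1−λ)β/α}·e^{−λ/(1−α)}) ≤ 0.5839`. -/
theorem stmt_4 (α β lam : ℝ) (hα : α = 0.56) (hβ : β = 0.42)
    (hlam : lam ∈ Set.Icc (0:ℝ) 1) :
    β * (1 - Real.exp (-((1 - lam) * β / α))) +
      (1 - β) * (1 - Real.exp (-((1 - lam) * β / α)) * Real.exp (-(lam / (1 - α)))) ≤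
      0.5839 := by
  obtain ⟨h0, h1⟩ := hlam
  subst hα hβ
  rw [← Real.exp_add]
  -- The left-hand side is nearly maximal at `lam = 0.45362`; expand both exponentials there.
  have hA : (0.663792 : ℝ) ≤ Real.exp (-0.75 * (1 - 0.45362)) := by
    refine le_trans ?_ (taylor_sub_le_exp ?_) <;> norm_num [abs_of_neg, abs_le]
  have hB : (0.236750 : ℝ) ≤ Real.exp (-0.75 - 67 / 44 * 0.45362) := by
    have h : (0.486570 : ℝ) ≤ Real.exp ((-0.75 - 67 / 44 * 0.45362) / 2) := by
      refine le_trans ?_ (taylor_sub_le_exp ?_) <;> norm_num [abs_of_neg, abs_le]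
    rw [← add_halves (-0.75 - 67 / 44 * 0.45362 : ℝ), Real.exp_add]
    nlinarith
  have h₁ := mul_add_one_sub_le_exp (x := -((1 - lam) * 0.42 / 0.56)) hA
    (by norm_num; linarith)
  have h₂ := mul_add_one_sub_le_exp
    (x := -((1 - lam) * 0.42 / 0.56) + -(lam / (1 - 0.56))) hB (by norm_num; linarith)
  norm_num at h₁ h₂ ⊢
  linarith
end

section
/- The set function F is monotone and submodular, F(S) ∈ [0,1] for every S ⊆ V, and F(S) = 1 whenever |S| ≥ k/ε. -/
/-- The function `F` from the polynomial lower bound construction. -/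
noncomputable def Fdyn {V U : Type*} [DecidableEq V] [DecidableEq U] [Fintype U]
    (ε : ℝ) (k : ℕ) (A : U → Finset V) (D : Finset U → ℝ) (S : Finset V) : ℝ :=
  min
    (∑ R : Finset U, D R * (1 - ∏ u ∈ R, (1 - ((S ∩ A u).card : ℝ) / (ε * k)))
      + (ε / k) * S.card)
    1

/-- Products of nonnegative factors are supermodular along coordinatewise modular squares. -/
lemma prod_add_prod_le_of_add_eq {ι : Type*} (s : Finset ι) (a b c d : ι → ℝ)
    (ha : ∀ i, 0 ≤ a i) (hab : ∀ i, a i ≤ b i) (hac : ∀ i, a i ≤ c i)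
    (hbd : ∀ i, b i ≤ d i) (hcd : ∀ i, c i ≤ d i) (h : ∀ i, a i + d i = b i + c i) :
    ∏ i ∈ s, b i + ∏ i ∈ s, c i ≤ ∏ i ∈ s, a i + ∏ i ∈ s, d i := by
  classical
  induction s using Finset.induction_on with
  | empty => simp
  | insert j s hj ih =>
    simp only [Finset.prod_insert hj]
    have hB : ∏ i ∈ s, a i ≤ ∏ i ∈ s, b i :=
      Finset.prod_le_prod (fun i _ => ha i) (fun i _ => hab i)
    have hC : ∏ i ∈ s, a i ≤ ∏ i ∈ s, c i :=
      Finset.prod_le_prod (fun i _ => ha i) (fun i _ => hac i)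
    have hd : 0 ≤ d j := (ha j).trans ((hab j).trans (hbd j))
    have haj : a j = b j + c j - d j := by linarith [h j]
    rw [haj]
    nlinarith [mul_le_mul_of_nonneg_left ih hd,
      mul_nonneg (sub_nonneg.2 (hbd j)) (sub_nonneg.2 hB),
      mul_nonneg (sub_nonneg.2 (hcd j)) (sub_nonneg.2 hC)]

/-- Truncating from above preserves the submodular inequality of a monotone function. -/
lemma min_add_min_le_of_add_le {a b c d t : ℝ} (hba : b ≤ a) (hca : c ≤ a) (hdb : d ≤ b)
    (hdc : d ≤ c) (h : a + d ≤ b + c) : min a t + min d t ≤ min b t + min c t := by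
  grind

/-- The untruncated function `∑ R, D R * (1 - ∏ u ∈ R, (1 - |S ∩ A u| / m)) + c * |S|`. -/
noncomputable def weightedCoverage {V U : Type*} [DecidableEq V] [Fintype U] (m c : ℝ)
    (A : U → Finset V) (D : Finset U → ℝ) (S : Finset V) : ℝ :=
  ∑ R : Finset U, D R * (1 - ∏ u ∈ R, (1 - ((S ∩ A u).card : ℝ) / m)) + c * S.card

section weightedCoverage

variable {V U : Type*} [DecidableEq V] {m c : ℝ} {A : U → Finset V}
  {D : Finset U → ℝ}

lemma one_sub_card_inter_div_nonneg (hm : 0 < m) (hcard : ∀ u, ((A u).card : ℝ) = m)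
    (S : Finset V) (u : U) : 0 ≤ 1 - ((S ∩ A u).card : ℝ) / m := by
  rw [sub_nonneg, div_le_one hm, ← hcard u]
  exact_mod_cast Finset.card_le_card Finset.inter_subset_right

lemma one_sub_card_inter_div_anti (hm : 0 < m) {S T : Finset V} (h : S ⊆ T) (u : U) :
    1 - ((T ∩ A u).card : ℝ) / m ≤ 1 - ((S ∩ A u).card : ℝ) / m := by
  gcongr

variable [Fintype U]

lemma weightedCoverage_mono (hm : 0 < m) (hc : 0 ≤ c) (hcard : ∀ u, ((A u).card : ℝ) = m)
    (hD : ∀ R, 0 ≤ D R) {S T : Finset V} (h : S ⊆ T) :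
    weightedCoverage m c A D S ≤ weightedCoverage m c A D T := by
  unfold weightedCoverage
  refine add_le_add (Finset.sum_le_sum fun R _ => mul_le_mul_of_nonneg_left ?_ (hD R))
    (by gcongr)
  exact sub_le_sub_left (Finset.prod_le_prod
    (fun u _ => one_sub_card_inter_div_nonneg hm hcard T u)
    (fun u _ => one_sub_card_inter_div_anti hm h u)) 1

lemma mul_card_le_weightedCoverage (hm : 0 < m) (hcard : ∀ u, ((A u).card : ℝ) = m)
    (hD : ∀ R, 0 ≤ D R) (S : Finset V) : c * S.card ≤ weightedCoverage m c A D S := by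
  refine le_add_of_nonneg_left (Finset.sum_nonneg fun R _ => mul_nonneg (hD R) ?_)
  exact sub_nonneg.2 (Finset.prod_le_one
    (fun u _ => one_sub_card_inter_div_nonneg hm hcard S u)
    (fun u _ => sub_le_self 1 (by positivity)))

lemma weightedCoverage_union_add_inter_le (hm : 0 < m) (hcard : ∀ u, ((A u).card : ℝ) = m)
    (hD : ∀ R, 0 ≤ D R) (S T : Finset V) :
    weightedCoverage m c A D (S ∪ T) + weightedCoverage m c A D (S ∩ T) ≤
      weightedCoverage m c A D S + weightedCoverage m c A D T := by
  have hST : ((S ∪ T).card : ℝ) + (S ∩ T).card = S.card + T.card := by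
    exact_mod_cast Finset.card_union_add_card_inter S T
  have hsum : ∑ R : Finset U, D R * (1 - ∏ u ∈ R, (1 - (((S ∪ T) ∩ A u).card : ℝ) / m)) +
      ∑ R : Finset U, D R * (1 - ∏ u ∈ R, (1 - (((S ∩ T) ∩ A u).card : ℝ) / m)) ≤
      ∑ R : Finset U, D R * (1 - ∏ u ∈ R, (1 - ((S ∩ A u).card : ℝ) / m)) +
      ∑ R : Finset U, D R * (1 - ∏ u ∈ R, (1 - ((T ∩ A u).card : ℝ) / m)) := by
    rw [← Finset.sum_add_distrib, ← Finset.sum_add_distrib]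
    refine Finset.sum_le_sum fun R _ => ?_
    rw [← mul_add, ← mul_add]
    refine mul_le_mul_of_nonneg_left ?_ (hD R)
    have := prod_add_prod_le_of_add_eq R
      (fun u => 1 - (((S ∪ T) ∩ A u).card : ℝ) / m) (fun u => 1 - ((S ∩ A u).card : ℝ) / m)
      (fun u => 1 - ((T ∩ A u).card : ℝ) / m) (fun u => 1 - (((S ∩ T) ∩ A u).card : ℝ) / m)
      (one_sub_card_inter_div_nonneg hm hcard _)
      (one_sub_card_inter_div_anti hm Finset.subset_union_left)
      (one_sub_card_inter_div_anti hm Finset.subset_union_right)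
      (one_sub_card_inter_div_anti hm Finset.inter_subset_left)
      (one_sub_card_inter_div_anti hm Finset.inter_subset_right)
      (fun u => by
        have key : (((S ∪ T) ∩ A u).card : ℝ) + ((S ∩ T) ∩ A u).card
            = (S ∩ A u).card + (T ∩ A u).card := by
          rw [Finset.union_inter_distrib_right, Finset.inter_inter_distrib_right]
          exact_mod_cast Finset.card_union_add_card_inter (S ∩ A u) (T ∩ A u)
        have hdiv := congrArg (· / m) key
        simp only [add_div] at hdiv
        linarith)
    linarith
  have hlin := congrArg (c * ·) hST
  simp only [mul_add] at hlin
  unfold weightedCoverage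
  linarith

end weightedCoverage

/-- `F` is monotone and submodular, takes values in `[0,1]`, and
`F(S) = 1` whenever `|S| ≥ k/ε`. -/
theorem stmt_6 {V U : Type*} [DecidableEq V] [Fintype V] [DecidableEq U] [Fintype U]
    (ε : ℝ) (hε : ε ∈ Set.Ioc (0:ℝ) 1) (k : ℕ) (hk : 0 < k)
    (hεk : ∃ n : ℕ, 0 < n ∧ (n : ℝ) = ε * k)
    (A : U → Finset V) (hdisj : ∀ u u', u ≠ u' → Disjoint (A u) (A u'))
    (hcard : ∀ u, ((A u).card : ℝ) = ε * k)
    (D : Finset U → ℝ) (hD : ∀ R, 0 ≤ D R) (hDsum : ∑ R : Finset U, D R = 1) :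
    (∀ S T : Finset V, S ⊆ T → Fdyn ε k A D S ≤ Fdyn ε k A D T) ∧
    (∀ S T : Finset V,
      Fdyn ε k A D (S ∪ T) + Fdyn ε k A D (S ∩ T) ≤ Fdyn ε k A D S + Fdyn ε k A D T) ∧
    (∀ S : Finset V, Fdyn ε k A D S ∈ Set.Icc (0:ℝ) 1) ∧
    (∀ S : Finset V, (k : ℝ) / ε ≤ S.card → Fdyn ε k A D S = 1) := by
  have hε0 : 0 < ε := hε.1
  have hk0 : (0 : ℝ) < k := by exact_mod_cast hk
  have hm : 0 < ε * k := mul_pos hε0 hk0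
  have hc : 0 ≤ ε / k := by positivity
  have hF : ∀ S, Fdyn ε k A D S = min (weightedCoverage (ε * k) (ε / k) A D S) 1 :=
    fun _ => rfl
  have hmono : ∀ {S T : Finset V}, S ⊆ T →
      weightedCoverage (ε * k) (ε / k) A D S ≤ weightedCoverage (ε * k) (ε / k) A D T :=
    fun h => weightedCoverage_mono hm hc hcard hD h
  have hlow := mul_card_le_weightedCoverage (c := ε / k) hm hcard hD
  simp only [hF]
  refine ⟨fun S T h => min_le_min_right 1 (hmono h), fun S T => ?_, fun S => ⟨?_, ?_⟩,
    fun S hS => min_eq_right (le_trans ?_ (hlow S))⟩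
  · exact min_add_min_le_of_add_le (hmono Finset.subset_union_left)
      (hmono Finset.subset_union_right) (hmono Finset.inter_subset_left)
      (hmono Finset.inter_subset_right) (weightedCoverage_union_add_inter_le hm hcard hD S T)
  · exact le_min (le_trans (by positivity) (hlow S)) zero_le_one
  · exact min_le_right _ _
  · calc (1 : ℝ) = ε / k * (k / ε) := by field_simp
      _ ≤ ε / k * S.card := mul_le_mul_of_nonneg_left hS hc
end

section
/- For every j ∈ [L], one has w_j > 0 and a_j · ∏_{i=1}^{j−1} (1 − a_i/A_{≥i}) = 1. -/
/-- Backward recursion `δ` indexed by distance from `L`: `deltaAux 0 = δ_L = 1`. -/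
noncomputable def deltaAux : ℕ → ℝ
  | 0 => 1
  | t + 1 => 1 + ((1 + Real.sqrt (1 + 4 / deltaAux t)) / 2) * deltaAux t

/-- `δ_ℓ` for `1 ≤ ℓ ≤ L`. -/
noncomputable def deltaSeq (L ℓ : ℕ) : ℝ := deltaAux (L - ℓ)

/-- `a_ℓ = ∏_{i=1}^{ℓ-1} 1/(1 − 1/δ_i)`. -/
noncomputable def aSeq (L ℓ : ℕ) : ℝ := ∏ i ∈ Finset.Ico 1 ℓ, 1 / (1 - 1 / deltaSeq L i)

/-- `A_{≥j} = Σ_{i=j}^{L} a_i`. -/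
noncomputable def Ageq (L j : ℕ) : ℝ := ∑ i ∈ Finset.Icc j L, aSeq L i

theorem deltaAux_pos (t : ℕ) : 0 < deltaAux t := by
  induction t with
  | zero => simp [deltaAux]
  | succ t ih => rw [deltaAux]; positivity

theorem one_lt_deltaAux_succ (t : ℕ) : 1 < deltaAux (t + 1) := by
  have := deltaAux_pos t
  rw [deltaAux]
  exact lt_add_of_pos_right _ (by positivity)

theorem deltaAux_succ_sub_one_sq (t : ℕ) :
    (deltaAux (t + 1) - 1) ^ 2 = deltaAux (t + 1) * deltaAux t := by
  have hd := deltaAux_pos t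
  have hs : Real.sqrt (1 + 4 / deltaAux t) ^ 2 * deltaAux t = deltaAux t + 4 := by
    rw [Real.sq_sqrt (by positivity)]
    field_simp
  rw [deltaAux]
  linear_combination (deltaAux t / 4) * hs

theorem deltaSeq_pos (L i : ℕ) : 0 < deltaSeq L i := deltaAux_pos _

theorem one_lt_deltaSeq {L i : ℕ} (hi : i < L) : 1 < deltaSeq L i := by
  obtain ⟨t, ht⟩ : ∃ t, L - i = t + 1 := ⟨L - i - 1, by omega⟩
  rw [deltaSeq, ht]
  exact one_lt_deltaAux_succ t

theorem deltaSeq_sub_one_sq {L i : ℕ} (hi : i < L) :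
    (deltaSeq L i - 1) ^ 2 = deltaSeq L i * deltaSeq L (i + 1) := by
  have ht : L - i = L - (i + 1) + 1 := by omega
  rw [deltaSeq, deltaSeq, ht]
  exact deltaAux_succ_sub_one_sq _

theorem one_sub_one_div_deltaSeq_pos {L i : ℕ} (hi : i < L) : 0 < 1 - 1 / deltaSeq L i := by
  rw [sub_pos, div_lt_one (deltaSeq_pos L i)]
  exact one_lt_deltaSeq hi

theorem aSeq_pos {L j : ℕ} (hj : j ≤ L) : 0 < aSeq L j := by
  refine Finset.prod_pos fun i hi => one_div_pos.mpr (one_sub_one_div_deltaSeq_pos ?_)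
  exact (Finset.mem_Ico.mp hi).2.trans_le hj

theorem aSeq_succ (L : ℕ) {i : ℕ} (hi : 1 ≤ i) :
    aSeq L (i + 1) = aSeq L i * (1 / (1 - 1 / deltaSeq L i)) :=
  Finset.prod_Ico_succ_top hi _

theorem Ageq_eq_aSeq_mul_deltaSeq {L i : ℕ} (hi : 1 ≤ i) (hiL : i ≤ L) :
    Ageq L i = aSeq L i * deltaSeq L i := by
  induction hiL using Nat.decreasingInduction with
  | self => simp [Ageq, deltaSeq, deltaAux]
  | of_succ k hk ih =>
    have hsplit : Ageq L k = aSeq L k + Ageq L (k + 1) := by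
      rw [Ageq, Ageq, ← Finset.add_sum_Ioc_eq_sum_Icc hk.le, ← Finset.Icc_succ_left_eq_Ioc,
        Nat.succ_eq_succ]
    have hsub : deltaSeq L k - 1 ≠ 0 := (sub_pos.mpr (one_lt_deltaSeq hk)).ne'
    have hne := (deltaSeq_pos L k).ne'
    rw [hsplit, ih (by omega), aSeq_succ L hi, one_sub_div hne, one_div_div]
    field_simp
    linear_combination -aSeq L k * deltaSeq_sub_one_sq hk

/-- For every `j ∈ [L]`, `w_j > 0` and
`a_j · ∏_{i=1}^{j−1} (1 − a_i/A_{≥i}) = 1`, where `w_j = a_j / A_{≥1}`. -/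
theorem stmt_7 (L : ℕ) (hL : 0 < L) (j : ℕ) (hj1 : 1 ≤ j) (hjL : j ≤ L) :
    0 < aSeq L j / Ageq L 1 ∧
    aSeq L j * ∏ i ∈ Finset.Ico 1 j, (1 - aSeq L i / Ageq L i) = 1 := by
  constructor
  · rw [Ageq_eq_aSeq_mul_deltaSeq le_rfl hL]
    exact div_pos (aSeq_pos hjL) (mul_pos (aSeq_pos hL) (deltaSeq_pos L 1))
  · rw [aSeq, ← Finset.prod_mul_distrib]
    refine Finset.prod_eq_one fun i hi => ?_
    obtain ⟨hi1, hij⟩ := Finset.mem_Ico.mp hi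
    have hiL : i < L := hij.trans_le hjL
    rw [Ageq_eq_aSeq_mul_deltaSeq hi1 hiL.le, div_mul_cancel_left₀ (aSeq_pos hiL.le).ne',
      ← one_div (deltaSeq L i), one_div_mul_cancel (one_sub_one_div_deltaSeq_pos hiL).ne']
end

section
/- Let w ≥ 2 be an integer and x ∈ [0,1]^w. Then h(x) ≤ w·δ·(1 − x̄)^{w−1}, where δ = max_{i,j∈[w]} |x_i − x_j|. -/
/-- For `w ≥ 2` and `x ∈ [0,1]^w`, with
`δ = max_{i,j} |x_i − x_j|`, `h(x) = f(x) − g(x) ≤ w·δ·(1 − x̄)^{w−1}`. -/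
theorem stmt_12 (w : ℕ) (hw : 2 ≤ w) (x : Fin w → ℝ)
    (hx : ∀ i, x i ∈ Set.Icc (0:ℝ) 1) (δ : ℝ)
    (hδub : ∀ i j, |x i - x j| ≤ δ)
    (hδmem : ∃ i j, |x i - x j| = δ) :
    (1 - ∏ i, (1 - x i)) - (1 - (1 - (∑ i, x i) / w) ^ w) ≤
      w * δ * (1 - (∑ i, x i) / w) ^ (w - 1) := by
  have hw0 : (0 : ℝ) < w := by positivity
  set m : ℝ := (∑ i, x i) / w with hm
  have hsum : ∑ i, x i = w * m := by rw [hm]; field_simp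
  have hδ : 0 ≤ δ := by
    obtain ⟨i, j, h⟩ := hδmem
    exact h ▸ abs_nonneg _
  have hm1 : m ≤ 1 := by
    rw [hm, div_le_one hw0]
    simpa using Finset.sum_le_sum fun i (_ : i ∈ Finset.univ) => (hx i).2
  have hxm : ∀ i, x i ≤ m + δ := fun i => by
    have h := Finset.sum_le_sum fun j (_ : j ∈ Finset.univ) =>
      sub_le_iff_le_add.1 ((le_abs_self _).trans (hδub i j))
    simp only [Finset.sum_add_distrib, Finset.sum_const, Finset.card_univ, Fintype.card_fin,
      nsmul_eq_mul, hsum] at h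
    exact le_of_mul_le_mul_left (by linarith) hw0
  set a := 1 - m with ha
  have ha0 : 0 ≤ a := sub_nonneg.2 hm1
  have hpow : a ^ w = a * a ^ (w - 1) := (mul_pow_sub_one (by omega) a).symm
  suffices a ^ w - w * δ * a ^ (w - 1) ≤ ∏ i, (1 - x i) by linarith
  rcases le_or_gt a δ with hle | hlt
  · have hδw : a ≤ w * δ := hle.trans (le_mul_of_one_le_left hδ (by exact_mod_cast (by omega : 1 ≤ w)))
    calc a ^ w - w * δ * a ^ (w - 1) ≤ 0 := by
          rw [hpow]
          exact sub_nonpos.2 (mul_le_mul_of_nonneg_right hδw (by positivity))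
      _ ≤ ∏ i, (1 - x i) := Finset.prod_nonneg fun i _ => sub_nonneg.2 (hx i).2
  · have hapos : 0 < a := hδ.trans_lt hlt
    have hratio : δ / a ≤ 1 := (div_le_one hapos).2 hlt.le
    calc a ^ w - w * δ * a ^ (w - 1) = a ^ w * (1 + w * (-(δ / a))) := by
          rw [hpow]; field_simp; ring
      _ ≤ a ^ w * (1 + -(δ / a)) ^ w :=
          mul_le_mul_of_nonneg_left (one_add_mul_le_pow (by linarith) w) (by positivity)
      _ = (a - δ) ^ w := by rw [← mul_pow]; congr 1; field_simp; ring
      _ = ∏ _i : Fin w, (a - δ) := by simp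
      _ ≤ ∏ i, (1 - x i) :=
          Finset.prod_le_prod (fun _ _ => sub_nonneg.2 hlt.le) fun i _ => by linarith [hxm i]
end

section
/- Let w ≥ 2 be an integer and x ∈ [0,1]^w. Then h(x) ≥ w^{−4}·δ²·(1 − x̄)^{w−2}, where δ = max_{i,j∈[w]} |x_i − x_j| (with the convention 0^0 = 1 for the power (1 − x̄)^{w−2} when w = 2 and x̄ = 1). -/
/-- The inequality of arithmetic and geometric means, in the form `∏ yᵢ ≤ (mean of y) ^ w`. -/
theorem prod_le_mean_pow_s13 {w : ℕ} (hw : w ≠ 0) (y : Fin w → ℝ) (hy : ∀ i, 0 ≤ y i) :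
    ∏ i, y i ≤ ((∑ i, y i) / w) ^ w := by
  have hw' : (w : ℝ) ≠ 0 := by exact_mod_cast hw
  have h := Real.geom_mean_le_arith_mean_weighted Finset.univ (fun _ : Fin w => (w : ℝ)⁻¹) y
    (fun _ _ => by positivity) (by simp [hw']) (fun i _ => hy i)
  have h' := pow_le_pow_left₀
    (Finset.prod_nonneg fun i _ => Real.rpow_nonneg (hy i) _) h w
  rw [← Finset.prod_pow, ← Finset.mul_sum, ← div_eq_inv_mul] at h'
  simpa only [Real.rpow_inv_natCast_pow (hy _) hw] using h'

/-- The arithmetic-geometric mean inequality after replacing two entries by their average. -/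
theorem sq_average_mul_prod_erase_le_mean_pow {w : ℕ} (y : Fin w → ℝ) (hy : ∀ i, 0 ≤ y i)
    {i j : Fin w} (hij : i ≠ j) :
    ((y i + y j) / 2) ^ 2 * ∏ k ∈ (Finset.univ.erase i).erase j, y k ≤
      ((∑ k, y k) / w) ^ w := by
  have hj : j ∈ Finset.univ.erase i := by simp [hij.symm]
  set z : Fin w → ℝ := fun k => if k = i ∨ k = j then (y i + y j) / 2 else y k with hz
  have hz0 : ∀ k, 0 ≤ z k := by
    intro k
    have := hy i
    have := hy j
    have := hy k
    simp only [hz]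
    split_ifs <;> linarith
  have hzi : z i = (y i + y j) / 2 := by simp [hz]
  have hzj : z j = (y i + y j) / 2 := by simp [hz]
  have hzk : ∀ k ∈ (Finset.univ.erase i).erase j, z k = y k := by
    intro k hk
    simp only [Finset.mem_erase, Finset.mem_univ, and_true] at hk
    simp [hz, hk.1, hk.2]
  have hsum : ∑ k, z k = ∑ k, y k := by
    rw [← Finset.add_sum_erase _ z (Finset.mem_univ i), ← Finset.add_sum_erase _ z hj,
      ← Finset.add_sum_erase _ y (Finset.mem_univ i), ← Finset.add_sum_erase _ y hj,
      Finset.sum_congr rfl hzk, hzi, hzj]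
    ring
  have hprod : ∏ k, z k =
      ((y i + y j) / 2) ^ 2 * ∏ k ∈ (Finset.univ.erase i).erase j, y k := by
    rw [← Finset.mul_prod_erase _ z (Finset.mem_univ i), ← Finset.mul_prod_erase _ z hj,
      Finset.prod_congr rfl hzk, hzi, hzj]
    ring
  rw [← hprod, ← hsum]
  exact prod_le_mean_pow_s13 (Nat.ne_of_gt i.pos) z hz0

/-- A quantitative form of the arithmetic-geometric mean inequality. -/
theorem sq_sub_mul_mean_pow_le {w : ℕ} (hw : 2 ≤ w) (y : Fin w → ℝ) (hy : ∀ i, 0 ≤ y i)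
    (i j : Fin w) :
    ((w : ℝ) ^ 2)⁻¹ * (y i - y j) ^ 2 * ((∑ k, y k) / w) ^ (w - 2) ≤
      ((∑ k, y k) / w) ^ w - ∏ k, y k := by
  have hamgm := prod_le_mean_pow_s13 (by omega) y hy
  rcases eq_or_ne (y i) (y j) with h | h
  · simpa [h] using hamgm
  have hij : i ≠ j := fun e => h (by rw [e])
  have hj : j ∈ Finset.univ.erase i := by simp [hij.symm]
  have hw0 : (0 : ℝ) < w := by exact_mod_cast (by omega : 0 < w)
  have hpair : y i + y j ≤ ∑ k, y k := by
    rw [← Finset.add_sum_erase _ y (Finset.mem_univ i), ← Finset.add_sum_erase _ y hj]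
    have : 0 ≤ ∑ k ∈ (Finset.univ.erase i).erase j, y k := Finset.sum_nonneg fun k _ => hy k
    linarith
  have hpos : 0 < y i + y j := by
    rcases lt_or_gt_of_ne h with h | h <;> linarith [hy i, hy j]
  have hav := sq_average_mul_prod_erase_le_mean_pow y hy hij
  have hprod : ∏ k, y k = y i * y j * ∏ k ∈ (Finset.univ.erase i).erase j, y k := by
    rw [← Finset.mul_prod_erase _ y (Finset.mem_univ i), ← Finset.mul_prod_erase _ y hj]
    ring
  set R := ∏ k ∈ (Finset.univ.erase i).erase j, y k
  set S := ∑ k, y k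
  have hS : 0 < S := hpos.trans_le hpair
  have hpow : (S / w) ^ w = (S / w) ^ (w - 2) * (S / w) ^ 2 := by
    rw [← pow_add, Nat.sub_add_cancel hw]
  have hdiff : (y i - y j) ^ 2 * (S / w) ^ w ≤ S ^ 2 * ((S / w) ^ w - ∏ k, y k) := by
    have h1 : (y i - y j) ^ 2 * (S / w) ^ w ≤ (y i + y j) ^ 2 * ((S / w) ^ w - ∏ k, y k) := by
      have h2 := mul_le_mul_of_nonneg_left hav
        (mul_nonneg (mul_nonneg (by norm_num : (0 : ℝ) ≤ 4) (hy i)) (hy j))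
      rw [hprod]
      linarith
    refine h1.trans (mul_le_mul_of_nonneg_right ?_ (sub_nonneg.2 hamgm))
    exact pow_le_pow_left₀ hpos.le hpair 2
  refine le_of_mul_le_mul_left (le_of_eq_of_le ?_ hdiff) (pow_pos hS 2)
  rw [hpow]
  field_simp


/-- For `w ≥ 2` and `x ∈ [0,1]^w`, with
`δ = max_{i,j} |x_i − x_j|`, `h(x) = f(x) − g(x) ≥ w⁻⁴·δ²·(1 − x̄)^{w−2}`. -/
theorem stmt_13 (w : ℕ) (hw : 2 ≤ w) (x : Fin w → ℝ)
    (hx : ∀ i, x i ∈ Set.Icc (0:ℝ) 1) (δ : ℝ)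
    (hδub : ∀ i j, |x i - x j| ≤ δ)
    (hδmem : ∃ i j, |x i - x j| = δ) :
    ((w : ℝ) ^ 4)⁻¹ * δ ^ 2 * (1 - (∑ i, x i) / w) ^ (w - 2) ≤
      (1 - ∏ i, (1 - x i)) - (1 - (1 - (∑ i, x i) / w) ^ w) := by
  obtain ⟨i, j, rfl⟩ := hδmem
  have hw1 : (1 : ℝ) ≤ w := by exact_mod_cast (by omega : 1 ≤ w)
  have hmean : (∑ k, (1 - x k)) / w = 1 - (∑ k, x k) / w := by
    rw [Finset.sum_sub_distrib, sub_div]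
    simp [show (w : ℝ) ≠ 0 by positivity]
  have h := sq_sub_mul_mean_pow_le hw (fun k => 1 - x k) (fun k => sub_nonneg.2 (hx k).2) i j
  have hnonneg : 0 ≤ 1 - (∑ k, x k) / w := by
    rw [← hmean]
    exact div_nonneg (Finset.sum_nonneg fun k _ => sub_nonneg.2 (hx k).2) (by positivity)
  rw [hmean, show (1 - x i - (1 - x j)) ^ 2 = |x i - x j| ^ 2 by rw [sq_abs]; ring] at h
  calc _ ≤ ((w : ℝ) ^ 2)⁻¹ * |x i - x j| ^ 2 * (1 - (∑ i, x i) / w) ^ (w - 2) := by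
        gcongr
        norm_num
    _ ≤ _ := by linarith
end

section
/- Let w ≥ 2 be an integer, x ∈ [0,1]^w, and j ∈ [w]. Then | ∏_{i≠j} (1 − x_i) − (1 − x̄)^{w−1} | ≤ w·δ·(1 − x̄)^{w−2}, where δ = max_{i,i'∈[w]} |x_i − x_{i'}| (the left-hand side is exactly |∂h/∂x_j| for h(x) = f(x) − g(x); the convention 0^0 = 1 is used when w = 2 and x̄ = 1). -/
/-- Unweighted AM-GM inequality, with natural-number powers. -/
theorem Finset.prod_le_arith_mean_pow_card {ι : Type*} (s : Finset ι) (hs : s.Nonempty)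
    (z : ι → ℝ) (hz : ∀ i ∈ s, 0 ≤ z i) :
    ∏ i ∈ s, z i ≤ ((∑ i ∈ s, z i) / s.card) ^ s.card := by
  have hc : (0 : ℝ) < s.card := by exact_mod_cast hs.card_pos
  have h := Real.geom_mean_le_arith_mean s (fun _ => 1) z (fun _ _ => zero_le_one)
    (by simpa using hc) hz
  simp only [Real.rpow_one, one_mul, Finset.sum_const, nsmul_eq_mul, mul_one] at h
  have hp : 0 ≤ ∏ i ∈ s, z i := Finset.prod_nonneg hz
  calc ∏ i ∈ s, z i = ((∏ i ∈ s, z i) ^ ((s.card : ℝ)⁻¹)) ^ s.card :=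
        (Real.rpow_inv_natCast_pow hp hs.card_pos.ne').symm
    _ ≤ _ := pow_le_pow_left₀ (Real.rpow_nonneg hp _) h _

theorem pow_sub_pow_le_sub_mul {a b : ℝ} (hb : 0 ≤ b) (hab : b ≤ a) (n : ℕ) :
    a ^ n - b ^ n ≤ (a - b) * n * a ^ (n - 1) := by
  have h := (le_abs_self _).trans (abs_pow_sub_pow_le a b n)
  rwa [abs_of_nonneg (sub_nonneg.2 hab), abs_of_nonneg hb, abs_of_nonneg (hb.trans hab),
    max_eq_left hab] at h

theorem two_mul_pow_le_of_mul_le {a b : ℝ} (hb : 0 ≤ b) (k : ℕ)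
    (h : (k + 1) * b ≤ (k + 2) * a) : 2 * b ^ k ≤ (k + 2) * a ^ k := by
  have hk : (0 : ℝ) < k + 2 := by positivity
  have hinv : (1 : ℝ) / (k + 2) ≤ 1 := by
    rw [div_le_one hk]; linarith [(Nat.cast_nonneg k : (0 : ℝ) ≤ k)]
  have hbern := one_add_mul_le_pow (a := -(1 / ((k : ℝ) + 2))) (by linarith) k
  have hba : b * (1 + -(1 / ((k : ℝ) + 2))) ≤ a := by
    rw [show b * (1 + -(1 / ((k : ℝ) + 2))) = (k + 1) * b / (k + 2) by field_simp; ring,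
      div_le_iff₀ hk]
    linarith
  have hpow := pow_le_pow_left₀ (mul_nonneg hb (by linarith)) hba k
  rw [mul_pow] at hpow
  calc 2 * b ^ k = (k + 2) * (b ^ k * (1 + k * -(1 / ((k : ℝ) + 2)))) := by field_simp; ring
    _ ≤ (k + 2) * a ^ k := by
      gcongr
      exact (mul_le_mul_of_nonneg_left hbern (pow_nonneg hb k)).trans hpow

theorem abs_sub_mean_le_s14 {n : ℕ} (hn : 0 < n) (x : Fin n → ℝ) {δ : ℝ} (i : Fin n)
    (h : ∀ k, |x i - x k| ≤ δ) : |x i - (∑ k, x k) / n| ≤ δ := by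
  have hn' : (0 : ℝ) < n := by exact_mod_cast hn
  have hsum : x i - (∑ k, x k) / n = (∑ k, (x i - x k)) / n := by
    rw [Finset.sum_sub_distrib]
    simp
    field_simp
  rw [hsum, abs_div, abs_of_pos hn', div_le_iff₀ hn']
  calc |∑ k, (x i - x k)| ≤ ∑ k, |x i - x k| := Finset.abs_sum_le_sum_abs _ _
    _ ≤ ∑ _k : Fin n, δ := Finset.sum_le_sum fun k _ => h k
    _ = δ * n := by simp [mul_comm]


/-- For `w ≥ 2`, `x ∈ [0,1]^w` and `j ∈ [w]`, with
`δ = max_{i,i'} |x_i − x_{i'}|`,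
`|∏_{i≠j} (1 − x_i) − (1 − x̄)^{w−1}| ≤ w·δ·(1 − x̄)^{w−2}`
(the left-hand side is exactly `|∂h/∂x_j|` for `h = f − g`). -/
theorem stmt_14 (w : ℕ) (hw : 2 ≤ w) (x : Fin w → ℝ)
    (hx : ∀ i, x i ∈ Set.Icc (0:ℝ) 1) (j : Fin w) (δ : ℝ)
    (hδub : ∀ i i', |x i - x i'| ≤ δ)
    (hδmem : ∃ i i', |x i - x i'| = δ) :
    |(∏ i ∈ Finset.univ.erase j, (1 - x i)) - (1 - (∑ i, x i) / w) ^ (w - 1)| ≤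
      w * δ * (1 - (∑ i, x i) / w) ^ (w - 2) := by
  obtain ⟨k, rfl⟩ := Nat.exists_eq_add_of_le' hw
  have hδ : 0 ≤ δ := (abs_nonneg _).trans (hδub j j)
  have hmean : ∀ i, |x i - (∑ i, x i) / (k + 2 : ℕ)| ≤ δ := fun i =>
    abs_sub_mean_le_s14 (by lia) x i (hδub i)
  have hw0 : (0 : ℝ) < (k + 2 : ℕ) := by positivity
  have hk : (0 : ℝ) ≤ k := Nat.cast_nonneg k
  have hcard : (Finset.univ.erase j).card = k + 1 := by simp
  obtain ⟨p, hp⟩ := Finite.exists_max x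
  have hmean_le : (∑ i, x i) / (k + 2 : ℕ) ≤ x p := by
    rw [div_le_iff₀ hw0]
    calc ∑ i, x i ≤ ∑ _i : Fin (k + 2), x p := Finset.sum_le_sum fun i _ => hp i
      _ = x p * (k + 2 : ℕ) := by simp [mul_comm]
  set a : ℝ := 1 - (∑ i, x i) / (k + 2 : ℕ) with ha
  have hm : 0 ≤ 1 - x p := by linarith [(hx p).2]
  have hma : 1 - x p ≤ a := by linarith
  have ha0 : 0 ≤ a := hm.trans hma
  have hak : 0 ≤ a ^ k := pow_nonneg ha0 k
  rw [show k + 2 - 1 = k + 1 by lia, show k + 2 - 2 = k by lia, abs_sub_le_iff]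
  push_cast
  constructor
  · set b : ℝ := (∑ i ∈ Finset.univ.erase j, (1 - x i)) / (k + 1 : ℕ) with hb
    have hprod : ∏ i ∈ Finset.univ.erase j, (1 - x i) ≤ b ^ (k + 1) := by
      have h := Finset.prod_le_arith_mean_pow_card (Finset.univ.erase j)
        (Finset.card_pos.1 (by lia)) (fun i => 1 - x i) fun i _ => by linarith [(hx i).2]
      rwa [hcard] at h
    have hrel : (k + 1) * b + (1 - x j) = (k + 2) * a := by
      have h1 : (k + 1) * b = ∑ i ∈ Finset.univ.erase j, (1 - x i) := by
        rw [hb]; push_cast; field_simp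
      have h2 : (k + 2) * a = ∑ i, (1 - x i) := by
        rw [ha, Finset.sum_sub_distrib]; simp; field_simp
      rw [h1, h2, Finset.sum_erase_add _ _ (Finset.mem_univ j)]
    have hb0 : 0 ≤ b := div_nonneg
      (Finset.sum_nonneg fun i _ => by linarith [(hx i).2]) (Nat.cast_nonneg _)
    rcases le_total b a with hba | hab
    · have : b ^ (k + 1) ≤ a ^ (k + 1) := pow_le_pow_left₀ hb0 hba _
      have : 0 ≤ (k + 2) * δ * a ^ k := by positivity
      linarith
    · have h1 := pow_sub_pow_le_sub_mul ha0 hab (k + 1)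
      have h2 := two_mul_pow_le_of_mul_le hb0 k (a := a) (by linarith [(hx j).2])
      have h3 : (b - a) * (k + 1 : ℕ) ≤ δ := by
        push_cast
        have := (abs_le.1 (hmean j)).2
        linarith
      have h4 := mul_le_mul_of_nonneg_right h3 (pow_nonneg hb0 k)
      have h5 := mul_le_mul_of_nonneg_left h2 hδ
      have h6 : 0 ≤ δ * b ^ k := by positivity
      rw [Nat.add_sub_cancel] at h1
      linarith
  · have hprod : (1 - x p) ^ (k + 1) ≤ ∏ i ∈ Finset.univ.erase j, (1 - x i) := by
      rw [← hcard, ← Finset.prod_const]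
      exact Finset.prod_le_prod (fun _ _ => hm) fun i _ => by linarith [hp i]
    have h1 := pow_sub_pow_le_sub_mul hm hma (k + 1)
    have h2 : a - (1 - x p) ≤ δ := by linarith [(abs_le.1 (hmean p)).2]
    rw [Nat.add_sub_cancel] at h1
    push_cast at h1
    have h3 : (a - (1 - x p)) * (k + 1) * a ^ k ≤ δ * (k + 1) * a ^ k := by gcongr
    have h4 : 0 ≤ δ * a ^ k := by positivity
    linarith
end

section
/- Let M be a matroid on a finite ground set, let L ≥ 1, and let T_1, …, T_L be pairwise disjoint sets whose union T = T_1 ∪ ⋯ ∪ T_L is independent in M. Then every independent set O of M can be partitioned into pairwise disjoint sets O_1, …, O_L with O = O_1 ∪ ⋯ ∪ O_L such that: (1) if |O| ≥ |T| then |O_i| = |T_i| for all i < L; and if |O| < |T|, letting ℓ be the smallest index with |O| ≤ |T_1| + ⋯ + |T_ℓ|, then |O_i| = |T_i| for all i < ℓ and |O_ℓ| = |O| − (|O_1| + ⋯ + |O_{ℓ−1}|) (so O_i = ∅ for i > ℓ); (2) T_i ∩ O_j = ∅ for all i < j, and for every i < L the set T_1 ∪ ⋯ ∪ T_i ∪ O_{i+1}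 ∪ ⋯ ∪ O_L is independent in M. -/
open Finset in
/-- An independent set `A` can be extended to any size between `#A` and `#B` by elements of the
independent set `B`. -/
theorem exists_indep_union_of_card_le {α : Type*} [DecidableEq α] {Indep : Finset α → Prop}
    (haug : ∀ S T : Finset α, Indep S → Indep T → S.card < T.card →
      ∃ e ∈ T \ S, Indep (insert e S))
    {A B : Finset α} (hA : Indep A) (hB : Indep B) {n : ℕ} (hn : A.card + n ≤ B.card) :
    ∃ C ⊆ B, Disjoint A C ∧ C.card = n ∧ Indep (A ∪ C) := by
  induction n with
  | zero => exact ⟨∅, by simp, by simp, by simp, by simpa using hA⟩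
  | succ n ih =>
    obtain ⟨C, hCB, hAC, hC, hind⟩ := ih (by omega)
    obtain ⟨e, he, hind'⟩ := haug _ _ hind hB (by rw [card_union_of_disjoint hAC]; omega)
    simp only [mem_sdiff, mem_union, not_or] at he
    refine ⟨insert e C, insert_subset he.1 hCB, ?_, by rw [card_insert_of_notMem he.2.2, hC], ?_⟩
    · exact disjoint_insert_right.2 ⟨he.2.1, hAC⟩
    · rwa [union_insert]

open Finset in
/-- Exchanging an independent set `O` step by step against an increasing chain `P` of independent
sets starting at `∅`: the remainders `R i` decrease, and `P i ∪ R i` stays independent. -/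
theorem exists_antitone_exchange {α : Type*} [DecidableEq α] {Indep : Finset α → Prop}
    (haug : ∀ S T : Finset α, Indep S → Indep T → S.card < T.card →
      ∃ e ∈ T \ S, Indep (insert e S))
    {P : ℕ → Finset α} (hP : Monotone P) (hP0 : P 0 = ∅) (hind : ∀ i, Indep (P i))
    {O : Finset α} (hO : Indep O) :
    ∃ R : ℕ → Finset α, Antitone R ∧ R 0 = O ∧ ∀ i, Disjoint (P i) (R i) ∧
      (R i).card = O.card - (P i).card ∧ Indep (P i ∪ R i) := by
  have step : ∀ i S, (Disjoint (P i) S ∧ S.card = O.card - (P i).card ∧ Indep (P i ∪ S)) →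
      ∃ S' ⊆ S, Disjoint (P (i + 1)) S' ∧ S'.card = O.card - (P (i + 1)).card ∧
        Indep (P (i + 1) ∪ S') := by
    rintro i S ⟨hd, hc, hS⟩
    obtain hlt | hle := lt_or_ge O.card (P (i + 1)).card
    · exact ⟨∅, by simp, by simp, by simp; omega, by simpa using hind (i + 1)⟩
    obtain ⟨C, hCsub, hdC, hcC, hC⟩ := exists_indep_union_of_card_le haug (hind (i + 1)) hS
      (n := O.card - (P (i + 1)).card) (by rw [card_union_of_disjoint hd]; omega)
    refine ⟨C, fun x hx => ?_, hdC, hcC, hC⟩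
    exact (mem_union.1 (hCsub hx)).resolve_left fun h =>
      disjoint_left.1 hdC (hP (Nat.le_succ i) h) hx
  choose! f hsub hf using step
  let R : ℕ → Finset α := fun n => Nat.rec O f n
  have hR : ∀ i, Disjoint (P i) (R i) ∧ (R i).card = O.card - (P i).card ∧
      Indep (P i ∪ R i) := by
    intro i
    induction i with
    | zero => simpa [R, hP0] using hO
    | succ i ih => exact hf i (R i) ih
  exact ⟨R, antitone_nat_of_succ_le fun i => hsub i (R i) (hR i), rfl, hR⟩

open Finset in
theorem Antitone.biUnion_Icc_sdiff {α : Type*} [DecidableEq α] {R : ℕ → Finset α}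
    (hR : Antitone R) {m n : ℕ} (hmn : m ≤ n) :
    (Icc (m + 1) n).biUnion (fun i => R (i - 1) \ R i) = R m \ R n := by
  induction n, hmn using Nat.le_induction with
  | base => simp
  | succ n hmn ih =>
    rw [← insert_Icc_right_eq_Icc_add_one (by omega), biUnion_insert, ih, Nat.add_sub_cancel]
    ext x
    have h₁ := @hR m n hmn x
    have h₂ := @hR n (n + 1) (by omega) x
    simp only [mem_union, mem_sdiff]
    tauto

open Finset in
theorem Antitone.disjoint_sdiff_pred {α : Type*} [DecidableEq α] {R : ℕ → Finset α}
    (hR : Antitone R) {i j : ℕ} (hij : i < j) :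
    Disjoint (R (i - 1) \ R i) (R (j - 1) \ R j) :=
  disjoint_sdiff_self_left.mono_right (sdiff_subset.trans (hR (Nat.le_sub_one_of_lt hij)))


/-- the exchange / partition lemma for matroids (Lemma "folklore").
The matroid is given by an independence predicate `Indep` on finsets satisfying
the nonemptiness (of the family), downward-closure and augmentation axioms.
Sets `T 1, …, T L` are pairwise disjoint with independent union; every
independent set `O` can be partitioned into `Ofam 1, …, Ofam L` with the stated
cardinality and independence properties. -/
theorem stmt_15 {α : Type*} [DecidableEq α]
    (Indep : Finset α → Prop)
    (hempty : Indep ∅)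
    (hdown : ∀ S T : Finset α, S ⊆ T → Indep T → Indep S)
    (haug : ∀ S T : Finset α, Indep S → Indep T → S.card < T.card →
      ∃ e ∈ T \ S, Indep (insert e S))
    (L : ℕ) (hL : 1 ≤ L)
    (T : ℕ → Finset α)
    (hTdisj : ∀ i ∈ Finset.Icc 1 L, ∀ j ∈ Finset.Icc 1 L, i ≠ j → Disjoint (T i) (T j))
    (hTind : Indep ((Finset.Icc 1 L).biUnion T))
    (O : Finset α) (hO : Indep O) :
    ∃ Ofam : ℕ → Finset α,
      -- pairwise disjoint partition of O
      (∀ i ∈ Finset.Icc 1 L, ∀ j ∈ Finset.Icc 1 L, i ≠ j → Disjoint (Ofam i) (Ofam j)) ∧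
      O = (Finset.Icc 1 L).biUnion Ofam ∧
      -- (1) cardinality conditions
      (((Finset.Icc 1 L).biUnion T).card ≤ O.card →
        ∀ i, 1 ≤ i → i < L → (Ofam i).card = (T i).card) ∧
      (O.card < ((Finset.Icc 1 L).biUnion T).card →
        ∃ ℓ, 1 ≤ ℓ ∧ ℓ ≤ L ∧
          O.card ≤ ∑ i ∈ Finset.Icc 1 ℓ, (T i).card ∧
          (∀ ℓ', 1 ≤ ℓ' → ℓ' < ℓ → ¬ (O.card ≤ ∑ i ∈ Finset.Icc 1 ℓ', (T i).card)) ∧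
          (∀ i, 1 ≤ i → i < ℓ → (Ofam i).card = (T i).card) ∧
          (Ofam ℓ).card = O.card - ∑ i ∈ Finset.Icc 1 (ℓ - 1), (Ofam i).card ∧
          (∀ i, ℓ < i → i ≤ L → Ofam i = ∅)) ∧
      -- (2) disjointness across indices and prefix-exchange independence
      (∀ i j, 1 ≤ i → i < j → j ≤ L → Disjoint (T i) (Ofam j)) ∧
      (∀ i, 1 ≤ i → i < L →
        Indep ((Finset.Icc 1 i).biUnion T ∪ (Finset.Icc (i + 1) L).biUnion Ofam)) := by

  classical
  set P : ℕ → Finset α := fun i => (Finset.Icc 1 (min i L)).biUnion T with hPdef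
  have hPL : ∀ i ≤ L, P i = (Finset.Icc 1 i).biUnion T := fun i hi => by
    simp only [hPdef, min_eq_left hi]
  have hPmono : Monotone P := fun i j hij =>
    Finset.biUnion_subset_biUnion_of_subset_left _
      (Finset.Icc_subset_Icc_right (min_le_min_right L hij))
  have hPind : ∀ i, Indep (P i) := fun i => hdown _ _
    (Finset.biUnion_subset_biUnion_of_subset_left _
      (Finset.Icc_subset_Icc_right (min_le_right i L))) hTind
  have hPcard : ∀ i ≤ L, (P i).card = ∑ j ∈ Finset.Icc 1 i, (T j).card := fun i hi => by
    rw [hPL i hi, Finset.card_biUnion]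
    intro a ha b hb
    simp only [Finset.coe_Icc, Set.mem_Icc] at ha hb
    exact hTdisj a (by simp; omega) b (by simp; omega)
  have hPsucc : ∀ i, 1 ≤ i → i ≤ L → (P i).card = (P (i - 1)).card + (T i).card := by
    intro i hi hiL
    obtain ⟨k, rfl⟩ := Nat.exists_eq_add_of_le' hi
    rw [hPcard _ hiL, hPcard _ (by omega), Finset.sum_Icc_succ_top (by omega), Nat.add_sub_cancel]
  obtain ⟨S, hSanti, hS0, hS⟩ :=
    exists_antitone_exchange haug hPmono (by simp [hPdef]) hPind hO
  set R : ℕ → Finset α := fun i => if i < L then S i else ∅ with hRdef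
  have hRS : ∀ i < L, R i = S i := fun i hi => by simp only [hRdef, if_pos hi]
  have hRL : R L = ∅ := by simp [hRdef]
  have hR : Antitone R := by
    intro i j hij
    by_cases hj : j < L
    · rw [hRS j hj, hRS i (by omega)]
      exact hSanti hij
    · simp [hRdef, hj]
  have hR0 : R 0 = O := by rw [hRS 0 hL, hS0]
  have hRcard : ∀ i < L, (R i).card = O.card - (P i).card := fun i hi => by
    rw [hRS i hi, (hS i).2.1]
  have hRunion : ∀ i ≤ L, (Finset.Icc (i + 1) L).biUnion (fun i => R (i - 1) \ R i) = R i :=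
    fun i hi => by rw [hR.biUnion_Icc_sdiff hi, hRL, Finset.sdiff_empty]
  have hcard : ∀ i, (R (i - 1) \ R i).card = (R (i - 1)).card - (R i).card := fun i =>
    Finset.card_sdiff_of_subset (hR (Nat.sub_le i 1))
  have hcardT : ∀ i, 1 ≤ i → i < L → (P i).card ≤ O.card →
      (R (i - 1) \ R i).card = (T i).card := by
    intro i hi hiL hle
    have := hPsucc i hi hiL.le
    rw [hcard, hRcard i hiL, hRcard (i - 1) (by omega)]
    omega
  refine ⟨fun i => R (i - 1) \ R i, ?_, ?_, ?_, ?_, ?_, ?_⟩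
  · intro i _ j _ hij
    obtain h | h := lt_or_gt_of_ne hij
    · exact hR.disjoint_sdiff_pred h
    · exact (hR.disjoint_sdiff_pred h).symm
  · rw [← hR0]
    exact (hRunion 0 (Nat.zero_le L)).symm
  · intro hle i hi hiL
    rw [← hPL L le_rfl] at hle
    exact hcardT i hi hiL ((Finset.card_le_card (hPmono hiL.le)).trans hle)
  · intro hlt
    rw [← hPL L le_rfl] at hlt
    have hex : ∃ k, 1 ≤ k ∧ O.card ≤ ∑ i ∈ Finset.Icc 1 k, (T i).card :=
      ⟨L, hL, by rw [← hPcard L le_rfl]; exact hlt.le⟩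
    obtain ⟨l, ⟨hl1, hlO⟩, hmin⟩ : ∃ k, (1 ≤ k ∧ O.card ≤ ∑ i ∈ Finset.Icc 1 k, (T i).card) ∧
        ∀ m < k, ¬ (1 ≤ m ∧ O.card ≤ ∑ i ∈ Finset.Icc 1 m, (T i).card) :=
      ⟨Nat.find hex, Nat.find_spec hex, fun m hm => Nat.find_min hex hm⟩
    have hlL : l ≤ L := by
      by_contra! h
      exact hmin L h ⟨hL, by rw [← hPcard L le_rfl]; exact hlt.le⟩
    have hRl : R l = ∅ := by
      obtain h | rfl := hlL.lt_or_eq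
      · rw [← Finset.card_eq_zero, hRcard l h, hPcard l hlL]
        omega
      · exact hRL
    have hbefore : ∀ i, 1 ≤ i → i < l → (R (i - 1) \ R i).card = (T i).card := by
      intro i hi hil
      refine hcardT i hi (by omega) ?_
      rw [hPcard i (by omega)]
      by_contra! h
      exact hmin i hil ⟨hi, h.le⟩
    refine ⟨l, hl1, hlL, hlO, fun m hm hml h => hmin m hml ⟨hm, h⟩, hbefore, ?_, ?_⟩
    · have hsum : ∑ i ∈ Finset.Icc 1 (l - 1), (R (i - 1) \ R i).card = (P (l - 1)).card := by
        rw [hPcard _ (by omega)]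
        refine Finset.sum_congr rfl fun i hi => ?_
        rw [Finset.mem_Icc] at hi
        exact hbefore i hi.1 (by omega)
      beta_reduce
      rw [hsum, hRl, Finset.sdiff_empty, hRcard _ (by omega)]
    · intro i hli _
      have : R (i - 1) ⊆ ∅ := hRl ▸ hR (Nat.le_sub_one_of_lt hli)
      simp [Finset.subset_empty.1 this]
  · intro i j hi hij hjL
    have hsub : T i ⊆ P (j - 1) := by
      rw [hPL _ (by omega)]
      exact Finset.subset_biUnion_of_mem T (by simp; omega)
    beta_reduce
    rw [hRS (j - 1) (by omega)]
    exact ((hS (j - 1)).1.mono_left hsub).mono_right Finset.sdiff_subset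
  · intro i _ hiL
    rw [hRunion i hiL.le, ← hPL i hiL.le, hRS i hiL]
    exact (hS i).2.2
end

section
/- Let k be a positive integer and let OPT ≥ 0 and Δ ≥ 0 be reals. Let v_0, v_1, …, v_k be reals with v_0 = 0 and v_{i+1} − v_i ≥ (OPT − v_i)/k − Δ for every 0 ≤ i ≤ k−1. Then OPT − v_k ≤ (1 − 1/k)^k · OPT + k·Δ ≤ OPT/e + k·Δ, where e is Euler's number. -/
/-- A sequence contracting by a factor `q ∈ [0, 1]` up to an additive error `δ ≥ 0` at each step
accumulates an error of at most `δ` per step. -/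
theorem le_pow_mul_add_of_le_mul_add {q δ : ℝ} (hq0 : 0 ≤ q) (hq1 : q ≤ 1) (hδ : 0 ≤ δ)
    {u : ℕ → ℝ} {n : ℕ} (hu : ∀ i < n, u (i + 1) ≤ q * u i + δ) :
    u n ≤ q ^ n * u 0 + n * δ := by
  induction n with
  | zero => simp
  | succ n ih =>
    have hn : (n * δ) * q ≤ n * δ := mul_le_of_le_one_right (by positivity) hq1
    calc u (n + 1) ≤ q * u n + δ := hu n n.lt_succ_self
      _ ≤ q * (q ^ n * u 0 + n * δ) + δ := by
        gcongr
        exact ih fun i hi => hu i (hi.trans n.lt_succ_self)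
      _ = q ^ (n + 1) * u 0 + (n * δ) * q + δ := by ring
      _ ≤ q ^ (n + 1) * u 0 + n * δ + δ := by gcongr
      _ = q ^ (n + 1) * u 0 + (n + 1 : ℕ) * δ := by push_cast; ring

/-- the thresholded greedy recursion. If `v 0 = 0` and
`v (i+1) − v i ≥ (OPT − v i)/k − Δ` for all `i < k`, then
`OPT − v k ≤ (1 − 1/k)^k · OPT + k·Δ ≤ OPT/e + k·Δ`. -/
theorem stmt_16 (k : ℕ) (hk : 0 < k) (OPT Δ : ℝ) (hOPT : 0 ≤ OPT) (hΔ : 0 ≤ Δ)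
    (v : ℕ → ℝ) (hv0 : v 0 = 0)
    (hrec : ∀ i < k, (OPT - v i) / k - Δ ≤ v (i + 1) - v i) :
    OPT - v k ≤ (1 - 1 / (k : ℝ)) ^ k * OPT + k * Δ ∧
    (1 - 1 / (k : ℝ)) ^ k * OPT + k * Δ ≤ OPT / Real.exp 1 + k * Δ := by
  have hk1 : (1 : ℝ) ≤ k := by exact_mod_cast hk
  constructor
  · have hq0 : 0 ≤ 1 - 1 / (k : ℝ) := sub_nonneg.2 (div_le_one_of_le₀ hk1 (by positivity))
    have hq1 : 1 - 1 / (k : ℝ) ≤ 1 := sub_le_self 1 (by positivity)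
    have hstep : ∀ i < k, OPT - v (i + 1) ≤ (1 - 1 / (k : ℝ)) * (OPT - v i) + Δ := by
      intro i hi
      have hmul : (1 - 1 / (k : ℝ)) * (OPT - v i) = (OPT - v i) - (OPT - v i) / k := by ring
      linarith [hrec i hi]
    simpa [hv0] using
      le_pow_mul_add_of_le_mul_add (u := fun i => OPT - v i) hq0 hq1 hΔ hstep
  · rw [div_eq_inv_mul OPT, ← Real.exp_neg]
    gcongr
    exact Real.one_sub_div_pow_le_exp_neg hk1
end

section
/- Let m be a positive integer, c ∈ [0,1], η ≥ 0, and V a real number. Let v_0, v_1, …, v_m be reals satisfying v_τ − v_{τ−1} ≥ (1−c)·(V − v_τ)/m − η for every τ ∈ [m]. Then V − v_m ≤ (V − v_0)/(1 + (1−c)/m)^m + m·η. -/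
/-- A sequence that contracts by a factor `q ≥ 1` up to an additive loss `η ≥ 0` in each of its
first `m` steps loses at most `η` per step beyond the geometric decay. -/
theorem le_div_pow_add_mul_of_succ_mul_le {d : ℕ → ℝ} {q η : ℝ} (hq : 1 ≤ q) (hη : 0 ≤ η) {m : ℕ}
    (h : ∀ k < m, d (k + 1) * q ≤ d k + η) : d m ≤ d 0 / q ^ m + m * η := by
  have hq0 : 0 < q := by linarith
  induction m with
  | zero => simp
  | succ k ih =>
    have hk := ih fun j hj => h j (by omega)
    calc d (k + 1) ≤ (d k + η) / q := (le_div_iff₀ hq0).2 (h k k.lt_succ_self)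
      _ ≤ (d 0 / q ^ k + k * η + η) / q := by gcongr
      _ = d 0 / q ^ (k + 1) + (k + 1) * η / q := by field_simp; ring
      _ ≤ d 0 / q ^ (k + 1) + (k + 1) * η := by
        gcongr
        exact div_le_self (by positivity) hq
      _ = d 0 / q ^ (k + 1) + (k + 1 : ℕ) * η := by push_cast; rfl

/-- the accelerated continuous greedy recursion. If
`v τ − v (τ−1) ≥ (1−c)·(V − v τ)/m − η` for all `τ ∈ [m]`, then
`V − v m ≤ (V − v 0)/(1 + (1−c)/m)^m + m·η`. -/
theorem stmt_17 (m : ℕ) (hm : 0 < m) (c η V : ℝ)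
    (hc : c ∈ Set.Icc (0:ℝ) 1) (hη : 0 ≤ η)
    (v : ℕ → ℝ)
    (hrec : ∀ τ, 1 ≤ τ → τ ≤ m → (1 - c) * (V - v τ) / m - η ≤ v τ - v (τ - 1)) :
    V - v m ≤ (V - v 0) / (1 + (1 - c) / m) ^ m + m * η := by
  have hq : 1 ≤ 1 + (1 - c) / (m : ℝ) :=
    le_add_of_nonneg_right (div_nonneg (sub_nonneg.2 hc.2) m.cast_nonneg)
  refine le_div_pow_add_mul_of_succ_mul_le (d := fun τ => V - v τ) hq hη fun k hk => ?_
  have hstep := hrec (k + 1) (by omega) (by omega)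
  rw [Nat.add_sub_cancel, mul_div_right_comm] at hstep
  linarith
end

section
/- Let V be a finite ground set and let V_1, …, V_m be pairwise disjoint subsets of V. For each i ∈ [m], let f_i : 2^V → ℝ be a monotone submodular set function with values in [0,1] such that f_i(S) = f_i(S ∩ V_i) for every S ⊆ V. Then the set function F defined by F(S) = 1 − ∏_{i=1}^m (1 − f_i(S)) is monotone and submodular, and takes values in [0,1]. -/
/-- The inequality `b + c ≤ a + d` for reals with `0 ≤ d ≤ b, c ≤ a` is preserved by products. -/
theorem add_mul_le_add_mul_of_add_le_add {a b c d a' b' c' d' : ℝ}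
    (hd : 0 ≤ d) (hdc : d ≤ c) (hca : c ≤ a) (h : b + c ≤ a + d)
    (hb' : 0 ≤ b') (hdc' : d' ≤ c') (hca' : c' ≤ a') (h' : b' + c' ≤ a' + d') :
    b * b' + c * c' ≤ a * a' + d * d' := by
  have h₁ := mul_nonneg (sub_nonneg.2 hca) (sub_nonneg.2 hdc')
  have h₂ := mul_nonneg (sub_nonneg.2 hdc) (sub_nonneg.2 hca')
  have h₃ := mul_nonneg (sub_nonneg.2 h) hb'
  have h₄ : 0 ≤ (a + d - c) * (a' + d' - (b' + c')) :=
    mul_nonneg (by linarith) (sub_nonneg.2 h')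
  linarith

/-- The finite-product version of `add_mul_le_add_mul_of_add_le_add`. -/
theorem Finset.prod_add_prod_le_prod_add_prod {ι : Type*} (s : Finset ι) {a b c d : ι → ℝ}
    (hd : ∀ i, 0 ≤ d i) (hdb : ∀ i, d i ≤ b i) (hdc : ∀ i, d i ≤ c i) (hca : ∀ i, c i ≤ a i)
    (h : ∀ i, b i + c i ≤ a i + d i) :
    ∏ i ∈ s, b i + ∏ i ∈ s, c i ≤ ∏ i ∈ s, a i + ∏ i ∈ s, d i := by
  classical
  induction s using Finset.induction_on with
  | empty => simp
  | insert j s hj ih =>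
    simp only [Finset.prod_insert hj]
    exact add_mul_le_add_mul_of_add_le_add (hd j) (hdc j) (hca j) (h j)
      (Finset.prod_nonneg fun i _ => (hd i).trans (hdb i))
      (Finset.prod_le_prod (fun i _ => hd i) fun i _ => hdc i)
      (Finset.prod_le_prod (fun i _ => (hd i).trans (hdc i)) fun i _ => hca i) ih


/-- If `f₁,…,f_m` are monotone submodular `[0,1]`-valued set
functions supported on pairwise disjoint sets `V₁,…,V_m` (i.e. `fᵢ(S) = fᵢ(S ∩ Vᵢ)`),
then `F(S) = 1 − ∏ᵢ (1 − fᵢ(S))` is monotone, submodular and takes values in `[0,1]`. -/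
theorem stmt_19 {V : Type*} [DecidableEq V] [Fintype V] (m : ℕ)
    (Vs : Fin m → Finset V) (hdisj : ∀ i j, i ≠ j → Disjoint (Vs i) (Vs j))
    (f : Fin m → Finset V → ℝ)
    (hrange : ∀ i S, f i S ∈ Set.Icc (0:ℝ) 1)
    (hmono : ∀ i, ∀ S T : Finset V, S ⊆ T → f i S ≤ f i T)
    (hsub : ∀ i, ∀ S T : Finset V, f i (S ∪ T) + f i (S ∩ T) ≤ f i S + f i T)
    (hloc : ∀ i S, f i S = f i (S ∩ Vs i)) :
    (∀ S T : Finset V, S ⊆ T →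
      1 - ∏ i, (1 - f i S) ≤ 1 - ∏ i, (1 - f i T)) ∧
    (∀ S T : Finset V,
      (1 - ∏ i, (1 - f i (S ∪ T))) + (1 - ∏ i, (1 - f i (S ∩ T))) ≤
        (1 - ∏ i, (1 - f i S)) + (1 - ∏ i, (1 - f i T))) ∧
    (∀ S : Finset V, (1 - ∏ i, (1 - f i S)) ∈ Set.Icc (0:ℝ) 1) := by
  have hnn : ∀ S i, 0 ≤ 1 - f i S := fun S i => sub_nonneg.2 (hrange i S).2
  have hanti : ∀ S T : Finset V, S ⊆ T → ∀ i, 1 - f i T ≤ 1 - f i S :=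
    fun S T hST i => sub_le_sub_left (hmono i S T hST) 1
  refine ⟨fun S T hST => ?_, fun S T => ?_, fun S => ⟨?_, ?_⟩⟩
  · exact sub_le_sub_left
      (Finset.prod_le_prod (fun i _ => hnn T i) fun i _ => hanti S T hST i) 1
  · have key := Finset.prod_add_prod_le_prod_add_prod Finset.univ (hnn (S ∪ T))
      (hanti S _ Finset.subset_union_left) (hanti T _ Finset.subset_union_right)
      (hanti _ T Finset.inter_subset_right) (fun i => by linarith [hsub i S T])
    linarith
  · exact sub_nonneg.2 (Finset.prod_le_one (fun i _ => hnn S i)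
      fun i _ => sub_le_self 1 (hrange i S).1)
  · exact sub_le_self 1 (Finset.prod_nonneg fun i _ => hnn S i)
end
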